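/- arXiv:2105.14181 — 4 statements merged into one kernel-verified Lean document; each statement's English description precedes it below -/
import Mathlib

section
/- Let L ≠ ℚ be a number field. If β₁ ∈ (0,1) is a real zero of the Dedekind zeta function ζ_L, then 1 − β₁ ≥ d_L^{−11.7}. -/
open NumberField

namespace DZ
open MeasureTheory Real Complex Set

lemma summable_pi_prod {ι : Type*} [Fintype ι] {f : ℤ → ℝ} (hf : Summable f) (h0 : ∀ x, 0 ≤ f x) :
    Summable (fun m : ι → ℤ => ∏ i, f (m i)) := by
  classical
  refine summable_of_sum_le (c := (∑' x, f x) ^ (Fintype.card ι)) (fun m => Finset.prod_nonneg fun i _ => h0 _) ?_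
  intro s
  let t : ι → Finset ℤ := fun i => s.image (fun m => m i)
  have hs : s ⊆ Fintype.piFinset t := by
    intro m hm
    simp only [Fintype.mem_piFinset, t, Finset.mem_image]
    exact fun i => ⟨m, hm, rfl⟩
  calc _ ≤ ∑ m ∈ Fintype.piFinset t, ∏ i, f (m i) :=
        Finset.sum_le_sum_of_subset_of_nonneg hs fun m _ _ => Finset.prod_nonneg fun i _ => h0 _
    _ = ∏ i, ∑ x ∈ t i, f x := (Finset.prod_univ_sum _ _).symm
    _ ≤ ∏ i : ι, ∑' x, f x := Finset.prod_le_prod (fun i _ => Finset.sum_nonneg fun x _ => h0 x)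
        fun i _ => hf.sum_le_tsum _ fun x _ => h0 x
    _ = _ := by simp

lemma summable_gauss_int {a : ℝ} (ha : 0 < a) : Summable (fun m : ℤ => Real.exp (-a * (m : ℝ) ^ 2)) := by
  refine Summable.of_nonneg_of_le (fun _ => (Real.exp_pos _).le) (f := fun m : ℤ => Real.exp (-a * |(m : ℝ)|)) ?_ ?_
  · intro m
    apply Real.exp_le_exp.2
    have : |(m:ℝ)| ≤ (m:ℝ)^2 := by
      have h1 : |m| ≤ m ^ 2 := by
        rw [← sq_abs]
        rcases (abs_nonneg m).eq_or_lt with h | h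
        · rw [← h]; simp
        · nlinarith
      exact_mod_cast h1
    nlinarith
  · have h : Summable (fun n : ℕ => Real.exp (-a * |(n : ℝ)|)) := by
      have := Real.summable_exp_nat_mul_iff.2 (neg_lt_zero.2 ha)
      refine this.congr fun n => ?_
      rw [Nat.abs_cast]; ring_nf
    refine Summable.of_nat_of_neg ?_ ?_
    · simpa using h
    · simpa using h

lemma summable_gauss_pi {ι : Type*} [Fintype ι] {a : ℝ} (ha : 0 < a) :
    Summable (fun m : ι → ℤ => Real.exp (-a * ∑ i, (m i : ℝ) ^ 2)) := by
  refine (summable_pi_prod (ι := ι) (summable_gauss_int ha) fun _ => (Real.exp_pos _).le).congr fun m => ?_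
  rw [← Real.exp_sum, Finset.mul_sum]

/-- the quadratic form -/
noncomputable def qf {ι : Type*} [Fintype ι] (B : Matrix ι ι ℝ) (x : ι → ℝ) : ℝ := ∑ i, (B.mulVec x i) ^ 2

lemma qf_lower {ι : Type*} [Fintype ι] [DecidableEq ι] (B : Matrix ι ι ℝ) (hB : B.det ≠ 0) :
    ∃ c > 0, ∀ x, c * ∑ i, (x i) ^ 2 ≤ qf B x := by
  -- entries of inverse
  let C : ℝ := ∑ i, ∑ j, (B⁻¹ i j) ^ 2 + 1
  have hC : 0 < C := by positivity
  refine ⟨C⁻¹, by positivity, fun x => ?_⟩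
  rw [inv_mul_le_iff₀ hC]
  have hx : x = B⁻¹.mulVec (B.mulVec x) := by
    rw [Matrix.mulVec_mulVec, Matrix.nonsing_inv_mul _ (isUnit_iff_ne_zero.2 hB), Matrix.one_mulVec]
  have hq : 0 ≤ qf B x := Finset.sum_nonneg fun i _ => sq_nonneg _
  calc ∑ i, (x i)^2 = ∑ i, (∑ j, B⁻¹ i j * (B.mulVec x) j)^2 := by
        conv_lhs => rw [hx]
        rfl
    _ ≤ ∑ i, (∑ j, B⁻¹ i j ^ 2) * qf B x := Finset.sum_le_sum fun i _ => Finset.sum_mul_sq_le_sq_mul_sq _ _ _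
    _ = (∑ i, ∑ j, (B⁻¹ i j) ^ 2) * qf B x := by rw [Finset.sum_mul]
    _ ≤ C * qf B x := by gcongr; simp [C]

lemma qf_cont {ι : Type*} [Fintype ι] (B : Matrix ι ι ℝ) : Continuous (qf B) := by
  unfold qf; fun_prop

/-- the Gaussian -/
noncomputable def gs {ι : Type*} [Fintype ι] (B : Matrix ι ι ℝ) (x : ι → ℝ) : ℝ := Real.exp (-π * qf B x)

lemma gs_pos {ι : Type*} [Fintype ι] (B : Matrix ι ι ℝ) (x : ι → ℝ) : 0 < gs B x := Real.exp_pos _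

lemma gs_cont {ι : Type*} [Fintype ι] (B : Matrix ι ι ℝ) : Continuous (gs B) := by
  have := qf_cont B
  unfold gs; fun_prop

lemma gs_bound {ι : Type*} [Fintype ι] [DecidableEq ι] (B : Matrix ι ι ℝ) (hB : B.det ≠ 0) (R : ℝ) :
    ∃ g : (ι → ℤ) → ℝ, Summable g ∧ ∀ x : ι → ℝ, (∀ i, |x i| ≤ R) → ∀ m : ι → ℤ, gs B (fun i => x i + m i) ≤ g m := by
  obtain ⟨c, hc, h⟩ := qf_lower B hB
  refine ⟨fun m => Real.exp (π * c * (Fintype.card ι * R ^ 2)) * Real.exp (-(π * c / 2) * ∑ i, (m i : ℝ) ^ 2),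
    (summable_gauss_pi (by positivity)).mul_left _, fun x hx m => ?_⟩
  show _ ≤ Real.exp (π * c * (Fintype.card ι * R ^ 2)) * Real.exp (-(π * c / 2) * ∑ i, (m i : ℝ) ^ 2)
  rw [gs, ← Real.exp_add]
  apply Real.exp_le_exp.2
  have h1 := h (fun i => x i + m i)
  have h2 : ∑ i, (m i : ℝ)^2 / 2 - Fintype.card ι * R ^ 2 ≤ ∑ i, (x i + m i)^2 := by
    have : (Fintype.card ι : ℝ) * R ^ 2 = ∑ i : ι, (R ^ 2 :ℝ) := by simp
    rw [this, ← Finset.sum_sub_distrib]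
    refine Finset.sum_le_sum fun i _ => ?_
    have : (x i)^2 ≤ R ^ 2 := by rw [← sq_abs]; gcongr; exact hx i
    nlinarith [sq_nonneg (2 * x i + m i)]
  rw [← Finset.sum_div] at h2
  have h3 : π * (c * ((∑ i, (m i : ℝ)^2) / 2 - Fintype.card ι * R ^ 2)) ≤ π * qf B (fun i => x i + m i) := by
    gcongr
    exact (mul_le_mul_of_nonneg_left h2 hc.le).trans h1
  linarith

lemma gs_summable {ι : Type*} [Fintype ι] [DecidableEq ι] (B : Matrix ι ι ℝ) (hB : B.det ≠ 0) :
    Summable (fun m : ι → ℤ => gs B (fun i => m i)) := by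
  obtain ⟨g, hg, h⟩ := gs_bound B hB 1
  refine Summable.of_nonneg_of_le (fun _ => (gs_pos _ _).le) (fun m => ?_) hg
  simpa using h 0 (by simp) m

end DZ


namespace DZ
open MeasureTheory Real Complex Set

/-- Fourier transform of the gaussian -/
lemma gs_fourier {ι : Type*} [Fintype ι] [DecidableEq ι] (B : Matrix ι ι ℝ) (hB : B.det ≠ 0) (n : ι → ℝ) :
    ∫ x : ι → ℝ, cexp (-(2 * π * I * ((∑ i, n i * x i : ℝ) : ℂ))) * (gs B x : ℂ) =
      (|B.det|⁻¹ * gs (B⁻¹).transpose n : ℝ) := by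
  -- Gaussian in Euclidean space
  have key (w : ι → ℝ) : ∫ z : ι → ℝ, cexp (-(2 * π * I * ((∑ i, w i * z i : ℝ) : ℂ))) * (Real.exp (-π * ∑ i, (z i)^2) : ℂ)
      = (Real.exp (-π * ∑ i, (w i)^2) : ℝ) := by
    have h := fourier_gaussian_innerProductSpace (V := EuclideanSpace ℝ ι) (b := π) (by simpa using pi_pos) (WithLp.toLp 2 w)
    rw [Real.fourier_eq'] at h
    rw [← (PiLp.volume_preserving_toLp ι).integral_comp
      (MeasurableEquiv.toLp 2 (ι → ℝ)).measurableEmbedding] at h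
    have hpi : (π : ℂ) ≠ 0 := by exact_mod_cast pi_ne_zero
    rw [div_self hpi, Complex.one_cpow, one_mul] at h
    have hn (z : ι → ℝ) : ‖WithLp.toLp 2 z‖ ^ 2 = ∑ i, (z i)^2 := by
      rw [EuclideanSpace.norm_sq_eq]; simp
    have e1 : ((Real.exp (-π * ∑ i, (w i)^2) : ℝ) : ℂ) = cexp (-↑π ^ 2 * ↑‖WithLp.toLp 2 w‖ ^ 2 / ↑π) := by
      rw [Complex.ofReal_exp]
      congr 1
      rw [← Complex.ofReal_pow ‖_‖, hn]
      push_cast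
      field_simp
    rw [e1, ← h]
    congr 1
    ext z
    rw [smul_eq_mul, ← Complex.ofReal_pow ‖_‖, hn]
    congr 1
    · congr 1
      rw [PiLp.inner_apply]
      simp
      ring_nf
    · rw [Complex.ofReal_exp]; push_cast; rfl
  set w := (B⁻¹).transpose.mulVec n with hw
  let g : (ι → ℝ) → ℂ := fun z => cexp (-(2 * π * I * ((∑ i, w i * z i : ℝ) : ℂ))) * (Real.exp (-π * ∑ i, (z i)^2) : ℂ)
  have hmap := Real.map_matrix_volume_pi_eq_smul_volume_pi hB
  have hintg : ∫ x, g (Matrix.toLin' B x) = (|B.det|⁻¹ : ℝ) • ∫ z, g z := by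
    have hg : Continuous g := by
      dsimp only [g]; fun_prop
    rw [← integral_map (φ := Matrix.toLin' B) (LinearMap.continuous_on_pi _).aemeasurable hg.aestronglyMeasurable]
    rw [hmap, integral_smul_measure, ENNReal.toReal_ofReal (abs_nonneg _), abs_inv]
  have : ∀ x : ι → ℝ, cexp (-(2 * π * I * ((∑ i, n i * x i : ℝ) : ℂ))) * (gs B x : ℂ) = g (Matrix.toLin' B x) := by
    intro x
    simp only [g, Matrix.toLin'_apply, gs, qf]
    congr 5
    change n ⬝ᵥ x = w ⬝ᵥ B.mulVec x
    rw [hw, Matrix.mulVec_transpose, Matrix.dotProduct_mulVec, Matrix.vecMul_vecMul,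
      Matrix.nonsing_inv_mul _ (isUnit_iff_ne_zero.2 hB), Matrix.vecMul_one]
  simp_rw [this, hintg]
  simp only [g]
  rw [key w]
  simp [gs, qf, hw]

/-- the point of the torus under a real vector -/
def tmk {ι : Type*} (x : ι → ℝ) : UnitAddTorus ι := fun i => (x i : UnitAddCircle)

lemma tmk_quot {ι : Type*} : IsOpenQuotientMap (tmk (ι := ι)) :=
  IsOpenQuotientMap.piMap (f := fun _ : ι => ((↑) : ℝ → UnitAddCircle)) fun _ => QuotientAddGroup.isOpenQuotientMap_mk

lemma tmk_eq {ι : Type*} {x y : ι → ℝ} (h : tmk x = tmk y) : ∃ m : ι → ℤ, y = fun i => x i + m i := by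
  have h1 : ∀ i, ∃ m : ℤ, y i = x i + m := by
    intro i
    have := congrFun h i
    simp only [tmk] at this
    have h2 : ((y i - x i : ℝ) : UnitAddCircle) = 0 := by
      rw [AddCircle.coe_sub, this, sub_self]
    obtain ⟨m, hm⟩ := AddCircle.coe_eq_zero_iff (1:ℝ) |>.1 h2
    exact ⟨m, by simp at hm; linarith⟩
  choose m hm using h1
  exact ⟨m, funext hm⟩

lemma mFourier_tmk {ι : Type*} [Fintype ι] (n : ι → ℤ) (x : ι → ℝ) :
    UnitAddTorus.mFourier n (tmk x) = cexp (2 * π * I * ((∑ i, n i * x i : ℝ) : ℂ)) := by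
  simp only [UnitAddTorus.mFourier, tmk, ContinuousMap.coe_mk, fourier_coe_apply]
  rw [← Complex.exp_sum]
  congr 1
  push_cast
  rw [Finset.mul_sum]
  congr 1; ext i; ring_nf

end DZ


namespace DZ
open MeasureTheory Real Complex Set

/-- periodization -/
noncomputable def per {ι : Type*} [Fintype ι] (B : Matrix ι ι ℝ) (x : ι → ℝ) : ℝ :=
  ∑' m : ι → ℤ, gs B (fun i => x i + m i)

lemma per_periodic {ι : Type*} [Fintype ι] (B : Matrix ι ι ℝ) (x : ι → ℝ) (k : ι → ℤ) :
    per B (fun i => x i + k i) = per B x := by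
  unfold per
  rw [← (Equiv.addLeft k).tsum_eq (fun m : ι → ℤ => gs B (fun i => x i + m i))]
  congr 1; ext m; congr 1; ext i; simp; ring

lemma per_cont {ι : Type*} [Fintype ι] [DecidableEq ι] (B : Matrix ι ι ℝ) (hB : B.det ≠ 0) :
    Continuous (per B) := by
  rw [continuous_iff_continuousAt]
  intro x
  obtain ⟨g, hg, h⟩ := gs_bound B hB (‖x‖ + 1)
  have h1 : ContinuousOn (per B) (Metric.ball 0 (‖x‖ + 1)) := by
    refine continuousOn_tsum (u := g) (fun m => ?_) hg ?_
    · refine Continuous.continuousOn ((gs_cont B).comp ?_)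
      fun_prop
    · intro m y hy
      rw [Real.norm_of_nonneg (gs_pos _ _).le]
      refine h y (fun i => ?_) m
      rw [mem_ball_zero_iff] at hy
      exact (norm_le_pi_norm y i).trans hy.le
  exact h1.continuousAt (Metric.isOpen_ball.mem_nhds (by simp))

lemma pi_Ioc_union {ι : Type*} [Fintype ι] : (⋃ m : ι → ℤ, {x : ι → ℝ | ∀ i, x i ∈ Ioc (m i : ℝ) (m i + 1)}) = univ := by
  ext x
  simp only [mem_iUnion, mem_univ, iff_true]
  refine ⟨fun i => ⌈x i⌉ - 1, fun i => ?_⟩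
  have h1 := Int.ceil_lt_add_one (x i)
  have h2 := Int.le_ceil (x i)
  constructor <;> push_cast <;> linarith

lemma pi_Ioc_disj {ι : Type*} [Fintype ι] : Pairwise (Function.onFun Disjoint
    (fun m : ι → ℤ => {x : ι → ℝ | ∀ i, x i ∈ Ioc (m i : ℝ) (m i + 1)})) := by
  intro m k hmk
  rw [Function.onFun, Set.disjoint_left]
  intro x hx hy
  apply hmk
  ext i
  have h1 := hx i
  have h2 := hy i
  have h3 : (m i : ℝ) < k i + 1 := by linarith [h1.1, h2.2]
  have h4 : (k i : ℝ) < m i + 1 := by linarith [h1.2, h2.1]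
  have h3' : m i < k i + 1 := by exact_mod_cast h3
  have h4' : k i < m i + 1 := by exact_mod_cast h4
  omega

lemma meas_cube {ι : Type*} [Fintype ι] (m : ι → ℤ) :
    MeasurableSet {x : ι → ℝ | ∀ i, x i ∈ Ioc (m i : ℝ) (m i + 1)} := by
  rw [Set.ofPred_forall]
  exact MeasurableSet.iInter fun i => measurableSet_Ioc.preimage (measurable_pi_apply i)

lemma cube_finite {ι : Type*} [Fintype ι] (m : ι → ℤ) :
    volume {x : ι → ℝ | ∀ i, x i ∈ Ioc (m i : ℝ) (m i + 1)} < ⊤ := by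
  have : {x : ι → ℝ | ∀ i, x i ∈ Ioc (m i : ℝ) (m i + 1)} = Set.pi univ fun i => Ioc (m i : ℝ) (m i + 1) := by
    ext; simp
  rw [this, Real.volume_pi_Ioc]
  simp

lemma integral_unfold_cube {ι : Type*} [Fintype ι] (f : (ι → ℝ) → ℂ) (hf : Integrable f) :
    ∑' m : ι → ℤ, ∫ x in {x : ι → ℝ | ∀ i, x i ∈ Ioc (0 : ℝ) (0 + 1)}, f (fun i => x i + m i) = ∫ x, f x := by
  have h := integral_iUnion (μ := volume) (f := f) (meas_cube (ι := ι)) pi_Ioc_disj hf.integrableOn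
  rw [pi_Ioc_union, setIntegral_univ] at h
  rw [h]
  congr 1; ext m
  have := (measurePreserving_add_right (volume : Measure (ι → ℝ)) (fun i => (m i : ℝ))).setIntegral_preimage_emb
    (MeasurableEquiv.addRight (fun i => (m i : ℝ))).measurableEmbedding f {x : ι → ℝ | ∀ i, x i ∈ Ioc (m i : ℝ) (m i + 1)}
  rw [← this]
  congr 2
  ext x
  simp only [mem_ofPred_eq, mem_preimage, mem_Ioc, Pi.add_apply]
  refine forall_congr' fun i => ?_
  constructor <;> rintro ⟨h1, h2⟩ <;> constructor <;> linarith

lemma gs_integrable {ι : Type*} [Fintype ι] [DecidableEq ι] (B : Matrix ι ι ℝ) (hB : B.det ≠ 0) :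
    Integrable (gs B) := by
  by_contra h
  have h1 := gs_fourier B hB 0
  have h2 : ∫ x : ι → ℝ, cexp (-(2 * π * I * ((∑ i, (0 : ι → ℝ) i * x i : ℝ) : ℂ))) * (gs B x : ℂ) = ((∫ x, gs B x : ℝ) : ℂ) := by
    refine Eq.trans ?_ integral_ofReal
    congr 1; ext x; simp
  rw [h2, integral_undef h] at h1
  have h3 : 0 < |B.det|⁻¹ * gs (B⁻¹).transpose 0 := by
    have := gs_pos (B⁻¹).transpose 0
    positivity
  have : (0:ℝ) = |B.det|⁻¹ * gs (B⁻¹).transpose 0 := by exact_mod_cast h1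
  linarith

theorem poisson {ι : Type*} [Fintype ι] [DecidableEq ι] (B : Matrix ι ι ℝ) (hB : B.det ≠ 0) :
    ∑' m : ι → ℤ, gs B (fun i => m i) = |B.det|⁻¹ * ∑' m : ι → ℤ, gs (B⁻¹).transpose (fun i => m i) := by
  have hq := tmk_quot (ι := ι)
  let F0 : UnitAddTorus ι → ℂ := fun z => (per B (Function.surjInv hq.surjective z) : ℂ)
  have hF0 : ∀ x, F0 (tmk x) = per B x := by
    intro x
    have := Function.surjInv_eq hq.surjective (tmk x)
    obtain ⟨m, hm⟩ := tmk_eq this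
    simp only [F0]
    conv_rhs => rw [hm]
    rw [per_periodic]
  have hFc : Continuous F0 := by
    rw [hq.isQuotientMap.continuous_iff]
    have : F0 ∘ tmk = fun x => (per B x : ℂ) := funext hF0
    rw [this]
    exact continuous_ofReal.comp (per_cont B hB)
  let F : C(UnitAddTorus ι, ℂ) := ⟨F0, hFc⟩
  have hcoef (n : ι → ℤ) : UnitAddTorus.mFourierCoeff F n = (|B.det|⁻¹ * gs (B⁻¹).transpose (fun i => n i) : ℝ) := by
    rw [UnitAddTorus.mFourierCoeff_eq_integral F n (fun _ => 0), ← gs_fourier B hB]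
    rw [← integral_unfold_cube]
    swap
    · refine Integrable.bdd_mul (c := 1) (gs_integrable B hB).ofReal ?_ ?_
      · exact Continuous.aestronglyMeasurable (by fun_prop)
      · refine Filter.Eventually.of_forall fun x => ?_
        rw [Complex.norm_exp]; simp
    obtain ⟨g, hg, h⟩ := gs_bound B hB 1
    have e1 : ∀ (m : ι → ℤ) (x : ι → ℝ), cexp (-(2 * π * I * ((∑ i, (n i : ℝ) * (x i + m i) : ℝ) : ℂ))) =
        cexp (-(2 * π * I * ((∑ i, (n i : ℝ) * x i : ℝ) : ℂ))) := by
      intro m x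
      rw [Complex.exp_eq_exp_iff_exists_int]
      refine ⟨- ∑ i, n i * m i, ?_⟩
      simp_rw [mul_add]
      rw [Finset.sum_add_distrib]
      push_cast
      ring
    simp_rw [e1]
    rw [integral_tsum_of_summable_integral_norm]
    · congr 1
      ext x
      have : (fun i => (x i : UnitAddCircle)) = tmk x := rfl
      rw [this, tsum_mul_left, mFourier_tmk]
      change _ • F0 (tmk x) = _
      rw [hF0, smul_eq_mul, per, Complex.ofReal_tsum]
      congr 2
      simp only [Pi.neg_apply, Int.cast_neg, neg_mul, Finset.sum_neg_distrib, Complex.ofReal_neg, mul_neg]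
    · intro m
      refine Integrable.bdd_mul (c := 1) ?_ ?_ ?_
      · have : Integrable (fun x : ι → ℝ => gs B (fun i => x i + m i)) :=
          (gs_integrable B hB).comp_add_right (fun i => (m i : ℝ))
        exact this.ofReal.integrableOn
      · exact Continuous.aestronglyMeasurable (by fun_prop)
      · refine Filter.Eventually.of_forall fun x => ?_
        rw [Complex.norm_exp]; simp
    · have hv := cube_finite (ι := ι) 0
      simp only [Pi.zero_apply, Int.cast_zero] at hv
      refine Summable.of_nonneg_of_le (fun m => integral_nonneg fun x => norm_nonneg _) (fun m => ?_)
        (hg.mul_right (volume.real {x : ι → ℝ | ∀ i, x i ∈ Ioc (0 : ℝ) (0 + 1)}))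
      have := norm_setIntegral_le_of_norm_le_const (μ := volume) (C := g m)
        (f := fun x : ι → ℝ => ‖cexp (-(2 * π * I * ((∑ i, (n i : ℝ) * x i : ℝ) : ℂ))) * ((gs B fun i => x i + m i : ℝ) : ℂ)‖) hv ?_
      · exact (le_abs_self _).trans this
      · intro x hx
        have hm := meas_cube (ι := ι) 0
        rw [norm_norm, norm_mul, Complex.norm_exp, Complex.norm_real, Real.norm_of_nonneg (gs_pos _ _).le]
        simp only [neg_re, mul_re, re_ofNat, ofReal_re, im_ofNat, ofReal_im, mul_zero, sub_zero, I_re, mul_im, zero_mul,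
          add_zero, I_im, mul_one, sub_self, neg_zero, Real.exp_zero, one_mul]
        exact h x (fun i => by rw [abs_le]; constructor <;> linarith [(hx i).1, (hx i).2]) m
  have hB' : (B⁻¹).transpose.det ≠ 0 := by
    rw [Matrix.det_transpose, Matrix.det_nonsing_inv]
    simpa using hB
  have hs := gs_summable _ hB'
  have hs' : Summable (UnitAddTorus.mFourierCoeff F) := by
    rw [funext hcoef]
    exact (Complex.summable_ofReal.2 (hs.mul_left _))
  have hfin := (UnitAddTorus.hasSum_mFourier_series_apply_of_summable hs' (tmk 0)).tsum_eq
  simp_rw [hcoef, mFourier_tmk] at hfin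
  have h3 : F (tmk 0) = per B 0 := hF0 0
  rw [h3] at hfin
  simp only [Pi.zero_apply, mul_zero, Finset.sum_const_zero, Complex.ofReal_zero, Complex.exp_zero, smul_eq_mul, mul_one] at hfin
  rw [← Complex.ofReal_tsum, tsum_mul_left] at hfin
  have h4 := Complex.ofReal_injective hfin
  rw [h4, per]
  simp

end DZ


namespace DZ
open MeasureTheory Real Complex Set

open scoped MatrixOrder in
lemma poissonA {ι : Type*} [Fintype ι] [DecidableEq ι] (A A' : Matrix ι ι ℝ)
    (hA : A.PosSemidef) (h : A * A' = 1) :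
    (Summable fun m : ι → ℤ => Real.exp (-π * ∑ i, ∑ j, (m i : ℝ) * A i j * m j)) ∧
    (Summable fun m : ι → ℤ => Real.exp (-π * ∑ i, ∑ j, (m i : ℝ) * A' i j * m j)) ∧
    ∑' m : ι → ℤ, Real.exp (-π * ∑ i, ∑ j, (m i : ℝ) * A i j * m j) =
      (√A.det)⁻¹ * ∑' m : ι → ℤ, Real.exp (-π * ∑ i, ∑ j, (m i : ℝ) * A' i j * m j) := by
  obtain ⟨B, rfl⟩ := CStarAlgebra.nonneg_iff_eq_star_mul_self.mp hA.nonneg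
  rw [Matrix.star_eq_conjTranspose, Matrix.conjTranspose_eq_transpose_of_trivial] at *
  have key : ∀ (C : Matrix ι ι ℝ) (x : ι → ℝ),
      qf C x = ∑ i, ∑ j, x i * (C.transpose * C) i j * x j := by
    intro C x
    have : qf C x = (C.mulVec x) ⬝ᵥ (C.mulVec x) := by
      simp [qf, dotProduct, pow_two]
    rw [this, Matrix.dotProduct_mulVec, ← Matrix.mulVec_transpose, dotProduct_comm,
      Matrix.mulVec_mulVec]
    simp [dotProduct, Matrix.mulVec, Finset.mul_sum, mul_assoc]
  have hdet : B.det ≠ 0 := by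
    intro h0
    have := congrArg Matrix.det h
    simp [h0] at this
  have hA' : A' = (B⁻¹).transpose.transpose * (B⁻¹).transpose := by
    have hu : IsUnit B.det := isUnit_iff_ne_zero.mpr hdet
    have hu2 : IsUnit B.transpose.det := by rwa [Matrix.det_transpose]
    rw [Matrix.transpose_transpose, Matrix.transpose_nonsing_inv, ← Matrix.mul_inv_rev]
    exact (Matrix.inv_eq_right_inv h).symm
  have hd2 : (B⁻¹).transpose.det ≠ 0 := by
    rw [Matrix.det_transpose, Matrix.det_nonsing_inv]
    simpa using hdet
  have h1 := gs_summable B hdet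
  have h2 := gs_summable _ hd2
  have h3 := poisson B hdet
  rw [hA']
  simp only [gs, key] at h1 h2 h3
  refine ⟨h1, h2, ?_⟩
  rw [h3, Matrix.det_mul, Matrix.det_transpose, Real.sqrt_mul_self_eq_abs]

end DZ


namespace DZ
open MeasureTheory Real Complex Set NumberField
open scoped nonZeroDivisors

variable {K : Type} [Field K] [NumberField K]

/-- the weighted trace of a log vector -/
noncomputable def tau (t : InfinitePlace K → ℝ) : ℝ := ∑ v, (v.mult : ℝ) * t v

/-- the twisted quadratic form -/
noncomputable def Q (t : InfinitePlace K → ℝ) (x : K) : ℝ :=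
  ∑ v : InfinitePlace K, (v.mult : ℝ) * Real.exp (2 * t v) * (v x) ^ 2

lemma sum_mk (f : InfinitePlace K → ℝ) :
    ∑ φ : K →+* ℂ, f (InfinitePlace.mk φ) = ∑ v, (v.mult : ℝ) * f v := by
  classical
  rw [← Finset.sum_fiberwise' (s := Finset.univ) (g := InfinitePlace.mk) (f := f)]
  refine Finset.sum_congr rfl fun v _ => ?_
  rw [Finset.sum_const, InfinitePlace.card_filter_mk_eq, nsmul_eq_mul]

/-- complex Gram matrix -/
noncomputable def gc {ι : Type*} (b : ι → K) (t : InfinitePlace K → ℝ) : Matrix ι ι ℂ :=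
  fun i j => ∑ φ : K →+* ℂ, (Real.exp (2 * t (InfinitePlace.mk φ)) : ℂ) *
    (φ (b i) * (starRingEnd ℂ) (φ (b j)))

noncomputable def gr {ι : Type*} (b : ι → K) (t : InfinitePlace K → ℝ) : Matrix ι ι ℝ :=
  fun i j => (gc b t i j).re

lemma gc_conj {ι : Type*} (b : ι → K) (t : InfinitePlace K → ℝ) (i j : ι) :
    (starRingEnd ℂ) (gc b t i j) = gc b t i j := by
  unfold gc
  rw [map_sum]
  refine Fintype.sum_equiv (ComplexEmbedding.involutive_conjugate K).toPerm _ _ fun φ => ?_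
  rw [Function.Involutive.coe_toPerm, InfinitePlace.mk_conjugate_eq]
  simp only [map_mul, Complex.conj_ofReal, ComplexEmbedding.conjugate_coe_eq]

lemma gr_coe {ι : Type*} (b : ι → K) (t : InfinitePlace K → ℝ) (i j : ι) :
    (gr b t i j : ℂ) = gc b t i j := Complex.conj_eq_iff_re.mp (gc_conj b t i j)

lemma gr_form {ι : Type*} [Fintype ι] (b : ι → K) (t : InfinitePlace K → ℝ) (x : ι → ℝ) :
    ∑ i, ∑ j, x i * gr b t i j * x j = ∑ φ : K →+* ℂ, Real.exp (2 * t (InfinitePlace.mk φ)) *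
      ‖∑ i, (x i : ℂ) * φ (b i)‖ ^ 2 := by
  have : ((∑ i, ∑ j, x i * gr b t i j * x j : ℝ) : ℂ) =
     ((∑ φ : K →+* ℂ, Real.exp (2 * t (InfinitePlace.mk φ)) *
      ‖∑ i, (x i : ℂ) * φ (b i)‖ ^ 2 : ℝ) : ℂ) := by
    push_cast
    simp only [gr_coe, ← Complex.mul_conj', map_sum, map_mul, Complex.conj_ofReal, gc]
    simp only [Finset.mul_sum, Finset.sum_mul]
    rw [Finset.sum_comm' (t' := Finset.univ) (s' := fun _ => Finset.univ) (by simp)]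
    rw [Finset.sum_congr rfl fun i _ => Finset.sum_comm, Finset.sum_comm]
    refine Finset.sum_congr rfl fun φ _ => ?_
    refine Finset.sum_congr rfl fun i _ => ?_
    refine Finset.sum_congr rfl fun j _ => ?_
    push_cast
    ring
  exact_mod_cast this

lemma gr_form_int {ι : Type*} [Fintype ι] (b : ι → K) (t : InfinitePlace K → ℝ) (m : ι → ℤ) :
    ∑ i, ∑ j, (m i : ℝ) * gr b t i j * m j = Q t (∑ i, m i • b i) := by
  rw [gr_form b t (fun i => (m i : ℝ)), Q]
  rw [← Finset.sum_congr rfl fun v _ => (mul_assoc _ _ _).symm]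
  rw [← sum_mk fun v => Real.exp (2 * t v) * (v (∑ i, m i • b i)) ^ 2]
  refine Finset.sum_congr rfl fun φ _ => ?_
  simp

lemma gr_posSemidef {ι : Type*} [Fintype ι] (b : ι → K) (t : InfinitePlace K → ℝ) :
    (gr b t).PosSemidef := by
  rw [Matrix.posSemidef_iff_dotProduct_mulVec]
  refine ⟨?_, fun x => ?_⟩
  · ext i j
    simp only [Matrix.conjTranspose_apply, star_trivial]
    have : (gr b t j i : ℂ) = gr b t i j := by
      rw [gr_coe, gr_coe, ← gc_conj]
      simp only [gc, map_sum, map_mul, Complex.conj_conj, Complex.conj_ofReal]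
      refine Finset.sum_congr rfl fun φ _ => ?_
      ring
    exact_mod_cast this
  · have := gr_form b t x
    simp only [star_trivial, dotProduct, Matrix.mulVec, Finset.mul_sum]
    simp only [← mul_assoc]
    rw [this]
    positivity

/-- embedding matrix -/
noncomputable def em {ι : Type*} (b : ι → K) (e : ι ≃ (K →+* ℂ)) : Matrix ι ι ℂ :=
  fun i j => e j (b i)

lemma gc_eq {ι : Type*} [Fintype ι] [DecidableEq ι] (b : ι → K) (e : ι ≃ (K →+* ℂ))
    (t : InfinitePlace K → ℝ) :
    gc b t = em b e * Matrix.diagonal (fun j => (Real.exp (2 * t (InfinitePlace.mk (e j))) : ℂ)) *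
      (em b e).conjTranspose := by
  ext i j
  rw [Matrix.mul_apply]
  simp only [Matrix.mul_diagonal, Matrix.conjTranspose_apply, em, gc]
  rw [← e.sum_comp]
  refine Finset.sum_congr rfl fun φ _ => ?_
  simp only [RCLike.star_def]
  ring

lemma em_dual {ι : Type*} [Fintype ι] [DecidableEq ι] (b : Module.Basis ι ℚ K)
    (e : ι ≃ (K →+* ℂ)) :
    em b e * (em b.traceDual e).transpose = 1 := by
  ext i j
  simp only [Matrix.mul_apply, Matrix.transpose_apply, em]
  rw [e.sum_comp (fun φ => φ (b i) * φ (b.traceDual j))]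
  have h := trace_eq_sum_embeddings (K := ℚ) ℂ (x := b i * b.traceDual j)
  rw [← (RingHom.equivRatAlgHom K ℂ).sum_comp] at h
  have h2 := b.trace_mul_traceDual i j
  rw [h2] at h
  simp only [RingHom.equivRatAlgHom_apply, map_mul] at h
  simp only [RingHom.toRatAlgHom_apply] at h
  rw [← h, Matrix.one_apply]
  split_ifs <;> simp

lemma gr_mul_dual {ι : Type*} [Fintype ι] [DecidableEq ι] (b : Module.Basis ι ℚ K)
    (e : ι ≃ (K →+* ℂ)) (t : InfinitePlace K → ℝ) :
    gr b t * gr b.traceDual (-t) = 1 := by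
  have h1 := em_dual b e
  have h2 := mul_eq_one_comm.mp h1
  have h3 := congrArg Matrix.transpose h2
  rw [Matrix.transpose_mul, Matrix.transpose_transpose, Matrix.transpose_one] at h3
  have h4 := congrArg (fun M => M.map (starRingEnd ℂ)) h3
  have key : gc b t * (gc b.traceDual (-t)).map (starRingEnd ℂ) = 1 := by
    rw [gc_eq b e, gc_eq b.traceDual e]
    have h5 : (em b e).conjTranspose * (em b.traceDual e).map (starRingEnd ℂ) = 1 := by
      simpa [Matrix.map_mul, Matrix.conjTranspose, Matrix.map_one] using h4
    have h6 : (em b.traceDual e).conjTranspose.map (starRingEnd ℂ) =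
        (em b.traceDual e).transpose := by
      ext i j; simp
    rw [Matrix.map_mul, Matrix.map_mul, h6, Matrix.mul_assoc _ _ (em b e).conjTranspose,
      Matrix.mul_assoc _ _ (em b.traceDual e).transpose]
    have h9 : Matrix.diagonal (fun j => (Real.exp (2 * t (InfinitePlace.mk (e j))) : ℂ)) *
        (Matrix.diagonal (fun j => (Real.exp (2 * (-t) (InfinitePlace.mk (e j))) : ℂ))).map
          (starRingEnd ℂ) = 1 := by
      rw [Matrix.diagonal_map (map_zero _), Matrix.diagonal_mul_diagonal, ← Matrix.diagonal_one]
      congr 1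
      ext j
      simp only [Function.comp, Complex.conj_ofReal]
      rw [← Complex.ofReal_mul, ← Real.exp_add]
      simp
    rw [← Matrix.mul_assoc, Matrix.mul_assoc (em b e), Matrix.mul_assoc _ (em b e).conjTranspose,
      h5, Matrix.mul_one, Matrix.mul_assoc, ← Matrix.mul_assoc (Matrix.diagonal _), h9,
      Matrix.one_mul, h1]
  have h7 : (gc b.traceDual (-t)).map (starRingEnd ℂ) = gc b.traceDual (-t) := by
    ext i j; simp [gc_conj]
  rw [h7] at key
  ext i j
  have := congrFun (congrFun key i) j
  simp only [Matrix.mul_apply, ← gr_coe] at this ⊢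
  have h8 : ((1 : Matrix ι ι ℂ) i j) = (((1 : Matrix ι ι ℝ) i j : ℝ) : ℂ) := by
    simp only [Matrix.one_apply]; split_ifs <;> simp
  rw [h8] at this
  exact_mod_cast this


lemma gr_det {ι : Type*} [Fintype ι] [DecidableEq ι] (b : Module.Basis ι ℚ K)
    (e : ι ≃ (K →+* ℂ)) (t : InfinitePlace K → ℝ) :
    (gr b t).det = |(Algebra.discr ℚ b : ℝ)| * Real.exp (2 * tau t) := by
  have h1 : ((gr b t).det : ℂ) = (gc b t).det := by
    have : gc b t = (gr b t).map Complex.ofRealHom := by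
      ext i j; simp [gr_coe]
    rw [this, ← RingHom.mapMatrix_apply, ← RingHom.map_det]; rfl
  have h2 : ‖(em b e).det‖ ^ 2 = |(Algebra.discr ℚ b : ℝ)| := by
    have := Algebra.discr_eq_det_embeddingsMatrixReindex_pow_two ℚ ℂ b
      (e.trans (RingHom.equivRatAlgHom K ℂ))
    have h3 : Algebra.embeddingsMatrixReindex ℚ ℂ b (e.trans (RingHom.equivRatAlgHom K ℂ)) =
        em b e := by
      ext i j
      simp [Algebra.embeddingsMatrixReindex, Algebra.embeddingsMatrix, em]
    rw [h3] at this
    rw [← norm_pow, ← this]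
    simp
  have h4 : ∏ j, Real.exp (2 * t (InfinitePlace.mk (e j))) = Real.exp (2 * tau t) := by
    rw [← Real.exp_sum, ← Finset.mul_sum, e.sum_comp (fun φ => t (InfinitePlace.mk φ)), sum_mk, tau]
  rw [gc_eq b e, Matrix.det_mul, Matrix.det_mul, Matrix.det_diagonal, Matrix.det_conjTranspose] at h1
  rw [← h2, ← h4]
  have : (((gr b t).det : ℝ) : ℂ) = ((‖(em b e).det‖ ^ 2 *
      ∏ j, Real.exp (2 * t (InfinitePlace.mk (e j))) : ℝ) : ℂ) := by
    rw [h1, Complex.ofReal_mul, Complex.ofReal_pow, ← Complex.mul_conj', Complex.ofReal_prod]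
    simp only [RCLike.star_def]
    ring
  exact_mod_cast this

lemma tsum_basis {ι : Type*} [Fintype ι] (b : Module.Basis ι ℚ K) (S : Set K)
    (hS : ∀ x, x ∈ S ↔ x ∈ Submodule.span ℤ (Set.range b)) (f : K → ENNReal) :
    ∑' x : S, f x = ∑' m : ι → ℤ, f (∑ i, m i • b i) := by
  have hmem : ∀ m : ι → ℤ, ∑ i, m i • b i ∈ S := fun m => by
    rw [hS, Submodule.mem_span_range_iff_exists_fun]; exact ⟨m, rfl⟩
  let F : (ι → ℤ) → S := fun m => ⟨_, hmem m⟩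
  have hF : Function.Bijective F := by
    constructor
    · intro m m' h
      have h' : ∑ i, m i • b i = ∑ i, m' i • b i := congrArg Subtype.val h
      ext i
      have h2 := congrArg (fun y => b.repr y i) h'
      simp only [← Int.cast_smul_eq_zsmul ℚ, Module.Basis.repr_sum_self] at h2
      exact_mod_cast h2
    · rintro ⟨x, hx⟩
      have := (hS x).mp hx
      rw [Submodule.mem_span_range_iff_exists_fun] at this
      obtain ⟨c, hc⟩ := this
      exact ⟨c, Subtype.ext hc⟩
  rw [← (Equiv.ofBijective F hF).tsum_eq]
  rfl

/-- theta function of a fractional ideal -/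
noncomputable def theta (J : (FractionalIdeal (𝓞 K)⁰ K)ˣ) (t : InfinitePlace K → ℝ) : ENNReal :=
  ∑' x : {x : K | x ∈ (J : FractionalIdeal (𝓞 K)⁰ K)}, ENNReal.ofReal (Real.exp (-π * Q t x))

/-- dual as a unit -/
noncomputable def dualU (J : (FractionalIdeal (𝓞 K)⁰ K)ˣ) : (FractionalIdeal (𝓞 K)⁰ K)ˣ :=
  Units.mk0 (FractionalIdeal.dual ℤ ℚ (J : FractionalIdeal (𝓞 K)⁰ K))
    (FractionalIdeal.dual_ne_zero ℤ ℚ J.ne_zero)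

lemma discr_frac (J : (FractionalIdeal (𝓞 K)⁰ K)ˣ) :
    Algebra.discr ℚ (basisOfFractionalIdeal K J) =
      (FractionalIdeal.absNorm (J : FractionalIdeal (𝓞 K)⁰ K)) ^ 2 * discr K := by
  classical
  have hc : Fintype.card (Module.Free.ChooseBasisIndex ℤ (𝓞 K)) =
      Fintype.card (Module.Free.ChooseBasisIndex ℤ J) := by
    rw [← Module.finrank_eq_card_basis (integralBasis K),
      ← Module.finrank_eq_card_basis (basisOfFractionalIdeal K J)]
  let e := Fintype.equivOfCardEq hc
  have h := det_basisOfFractionalIdeal_eq_absNorm K J e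
  rw [← h, sq_abs, coe_discr]
  have h2 := Algebra.discr_of_matrix_vecMul (integralBasis K)
    ((integralBasis K).toMatrix ((basisOfFractionalIdeal K J).reindex e.symm))
  rw [Module.Basis.det_apply, ← h2]
  rw [← Algebra.discr_reindex ℚ (basisOfFractionalIdeal K J) e.symm]
  congr 1
  ext i
  have h4 := (integralBasis K).sum_toMatrix_smul_self
    (fun i => (basisOfFractionalIdeal K J) (e i)) i
  simp only [Matrix.vecMul, dotProduct, Matrix.map_apply, Function.comp]
  rw [Equiv.symm_symm, ← h4]
  refine Finset.sum_congr rfl fun k _ => ?_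
  rw [Algebra.smul_def, mul_comm]
  congr 3
  ext i j
  simp [Module.Basis.toMatrix_apply]

theorem theta_fe (J : (FractionalIdeal (𝓞 K)⁰ K)ˣ) (t : InfinitePlace K → ℝ) :
    theta J t = ENNReal.ofReal (((FractionalIdeal.absNorm (J : FractionalIdeal (𝓞 K)⁰ K) : ℝ) *
      √|(discr K : ℝ)| * Real.exp (tau t))⁻¹) * theta (dualU J) (-t) := by
  classical
  set b := basisOfFractionalIdeal K J with hb
  have hcard : Fintype.card (Module.Free.ChooseBasisIndex ℤ J) = Fintype.card (K →+* ℂ) := by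
    rw [NumberField.Embeddings.card, Module.finrank_eq_card_basis b]
  let e := Fintype.equivOfCardEq hcard
  obtain ⟨h1, h2, h3⟩ := poissonA _ _ (gr_posSemidef b t) (gr_mul_dual b e t)
  simp only [gr_form_int] at h1 h2 h3
  unfold theta
  rw [tsum_basis b {x : K | x ∈ (J : FractionalIdeal (𝓞 K)⁰ K)} (fun x => (mem_span_basisOfFractionalIdeal K).symm)
    (fun x => ENNReal.ofReal (Real.exp (-π * Q t x))),
    tsum_basis b.traceDual _ ?_ (fun x => ENNReal.ofReal (Real.exp (-π * Q (-t) x)))]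
  · rw [← ENNReal.ofReal_tsum_of_nonneg (fun _ => (Real.exp_pos _).le) h1,
      ← ENNReal.ofReal_tsum_of_nonneg (fun _ => (Real.exp_pos _).le) h2, h3,
      ENNReal.ofReal_mul (by positivity)]
    congr 3
    rw [gr_det b e, hb, discr_frac]
    push_cast
    have hn : (0 : ℝ) ≤ (FractionalIdeal.absNorm (J : FractionalIdeal (𝓞 K)⁰ K) : ℝ) := by
      exact_mod_cast FractionalIdeal.absNorm_nonneg _
    rw [abs_mul, abs_of_nonneg (sq_nonneg _), Real.sqrt_mul (by positivity),
      Real.sqrt_mul (by positivity), Real.sqrt_sq hn]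
    congr 1
    rw [two_mul, Real.exp_add, Real.sqrt_mul_self (Real.exp_pos _).le]
  · intro x
    rw [← Submodule.traceDual_span_of_basis ℤ (J : Submodule (𝓞 K) K) b ?_]
    · rw [Submodule.restrictScalars_mem, ← FractionalIdeal.coe_dual]
      · rfl
      · exact J.ne_zero
    · ext x
      rw [mem_span_basisOfFractionalIdeal]
      rfl

end DZ


namespace DZ
open MeasureTheory Real Complex Set NumberField
open scoped nonZeroDivisors

set_option linter.unusedSectionVars false

variable {K : Type} [Field K] [NumberField K]

lemma countable_K : Countable K :=
  (Module.finBasis ℚ K).equivFun.injective.countable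

lemma countable_Kunits : Countable Kˣ := by
  have := countable_K (K := K)
  exact Function.Injective.countable (f := fun u : Kˣ => (u : K)) Units.val_injective

lemma countable_units : Countable (𝓞 K)ˣ := by
  have := countable_K (K := K)
  refine Function.Injective.countable (f := fun u : (𝓞 K)ˣ => ((u : 𝓞 K) : K)) ?_
  exact RingOfIntegers.coe_injective.comp Units.val_injective

lemma theta_ne_top (J : (FractionalIdeal (𝓞 K)⁰ K)ˣ) (t : InfinitePlace K → ℝ) :
    theta J t ≠ ⊤ := by
  classical
  set b := basisOfFractionalIdeal K J with hb
  have hcard : Fintype.card (Module.Free.ChooseBasisIndex ℤ J) = Fintype.card (K →+* ℂ) := by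
    rw [NumberField.Embeddings.card, Module.finrank_eq_card_basis b]
  let e := Fintype.equivOfCardEq hcard
  obtain ⟨h1, -, -⟩ := poissonA _ _ (gr_posSemidef b t) (gr_mul_dual b e t)
  simp only [gr_form_int] at h1
  unfold theta
  rw [tsum_basis b {x : K | x ∈ (J : FractionalIdeal (𝓞 K)⁰ K)}
    (fun x => (mem_span_basisOfFractionalIdeal K).symm)
    (fun x => ENNReal.ofReal (Real.exp (-π * Q t x)))]
  rw [← ENNReal.ofReal_tsum_of_nonneg (fun _ => (Real.exp_pos _).le) h1]
  exact ENNReal.ofReal_ne_top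

/-- the logarithm vector -/
noncomputable def ell (x : K) : InfinitePlace K → ℝ := fun v => Real.log (v x)

/-- the Gaussian -/
noncomputable def G (t : InfinitePlace K → ℝ) : ENNReal := ENNReal.ofReal (Real.exp (-π * Q t 1))

lemma G_ell (t : InfinitePlace K → ℝ) {x : K} (hx : x ≠ 0) :
    G (t + ell x) = ENNReal.ofReal (Real.exp (-π * Q t x)) := by
  unfold G Q ell
  congr 4
  ext v
  have hv : 0 < v x := InfinitePlace.pos_iff.mpr hx
  simp only [Pi.add_apply, map_one, mul_add, Real.exp_add]
  have : Real.exp (2 * Real.log (v x)) = (v x) ^ 2 := by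
    rw [mul_comm, Real.exp_mul, Real.exp_log hv, Real.rpow_two]
  rw [this]; ring

lemma ell_mul {x y : K} (hx : x ≠ 0) (hy : y ≠ 0) : ell (x * y) = ell x + ell y := by
  ext v
  simp only [ell, map_mul, Pi.add_apply]
  exact Real.log_mul ((InfinitePlace.pos_iff.mpr hx).ne') ((InfinitePlace.pos_iff.mpr hy).ne')

lemma ell_inv (x : K) : ell x⁻¹ = - ell x := by
  ext v
  simp [ell]

lemma tau_add (s t : InfinitePlace K → ℝ) : tau (s + t) = tau s + tau t := by
  simp [tau, mul_add, Finset.sum_add_distrib]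

lemma tau_neg (t : InfinitePlace K → ℝ) : tau (-t) = - tau t := by
  simp [tau]

lemma tau_ell {x : K} (hx : x ≠ 0) : tau (ell x) = Real.log |(Algebra.norm ℚ x : ℝ)| := by
  unfold tau ell
  have h := InfinitePlace.prod_eq_abs_norm x
  have : ((|Algebra.norm ℚ x| : ℚ) : ℝ) = |(Algebra.norm ℚ x : ℝ)| := by push_cast; rfl
  rw [← this, ← h, Real.log_prod]
  · simp
  · intro v _
    have hv : 0 < v x := InfinitePlace.pos_iff.mpr hx
    positivity

lemma tau_ell_unit (u : (𝓞 K)ˣ) : tau (ell ((u : 𝓞 K) : K)) = 0 := by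
  rw [tau_ell (by simp)]
  have : |(Algebra.norm ℚ ((u : 𝓞 K) : K))| = 1 := by
    have := (NumberField.isUnit_iff_norm (K := K) (x := (u : 𝓞 K))).mp u.isUnit
    exact_mod_cast this
  have h2 : |(Algebra.norm ℚ ((u : 𝓞 K) : K) : ℝ)| = 1 := by exact_mod_cast this
  rw [h2, Real.log_one]

lemma tau_const (c : ℝ) : tau (fun _ : InfinitePlace K => c) = Module.finrank ℚ K * c := by
  unfold tau
  rw [← Finset.sum_mul, ← InfinitePlace.sum_mult_eq]
  push_cast
  rfl

lemma tau_meas : Measurable (tau : (InfinitePlace K → ℝ) → ℝ) := by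
  unfold tau; fun_prop

lemma tau_cont : Continuous (tau : (InfinitePlace K → ℝ) → ℝ) := by
  unfold tau; fun_prop

lemma Q_cont (x : K) : Continuous (fun t : InfinitePlace K → ℝ => Q t x) := by
  unfold Q; fun_prop

lemma G_meas : Measurable (G : (InfinitePlace K → ℝ) → ENNReal) := by
  unfold G
  have := (Q_cont (1 : K)).measurable
  fun_prop

/-- sum over units -/
noncomputable def SU (t : InfinitePlace K → ℝ) : ENNReal :=
  ∑' u : (𝓞 K)ˣ, G (t + ell ((u : 𝓞 K) : K))

lemma SU_shift (t : InfinitePlace K → ℝ) (w : (𝓞 K)ˣ) :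
    SU (t + ell ((w : 𝓞 K) : K)) = SU t := by
  unfold SU
  rw [← (Equiv.mulLeft w).tsum_eq (fun u : (𝓞 K)ˣ => G (t + ell ((u : 𝓞 K) : K)))]
  congr 1; ext u
  simp only [Equiv.coe_mulLeft, Units.val_mul, map_mul]
  rw [ell_mul (by simp) (by simp), add_assoc]

lemma SU_ne_zero (t : InfinitePlace K → ℝ) : SU t ≠ 0 := by
  unfold SU
  rw [Ne, ENNReal.tsum_eq_zero]
  push Not
  exact ⟨1, by simp [G, Real.exp_pos]⟩

lemma SU_ne_top (t : InfinitePlace K → ℝ) : SU t ≠ ⊤ := by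
  refine ne_top_of_le_ne_top (theta_ne_top (1 : (FractionalIdeal (𝓞 K)⁰ K)ˣ) t) ?_
  unfold SU theta
  have hm : ∀ u : (𝓞 K)ˣ, ((u : 𝓞 K) : K) ∈
      {x : K | x ∈ ((1 : (FractionalIdeal (𝓞 K)⁰ K)ˣ) : FractionalIdeal (𝓞 K)⁰ K)} := by
    intro u
    simp only [Units.val_one, Set.mem_ofPred_eq]
    exact (FractionalIdeal.mem_one_iff _).mpr ⟨u, rfl⟩
  have := ENNReal.tsum_comp_le_tsum_of_injective (f := fun u : (𝓞 K)ˣ =>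
    (⟨_, hm u⟩ : {x : K | x ∈ ((1 : (FractionalIdeal (𝓞 K)⁰ K)ˣ) : FractionalIdeal (𝓞 K)⁰ K)}))
    (by
      intro u w h
      have := congrArg Subtype.val h
      exact Units.ext (RingOfIntegers.coe_injective this))
    (fun x => ENNReal.ofReal (Real.exp (-π * Q t x)))
  refine le_trans (le_of_eq ?_) this
  congr 1; ext u
  rw [G_ell t (by simp)]

/-- projection to trace zero -/
noncomputable def sh (t : InfinitePlace K → ℝ) : InfinitePlace K → ℝ :=
  fun v => t v - tau t / Module.finrank ℚ K

lemma sh_add_unit (t : InfinitePlace K → ℝ) (u : (𝓞 K)ˣ) :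
    sh (t + ell ((u : 𝓞 K) : K)) = sh t + ell ((u : 𝓞 K) : K) := by
  ext v
  simp only [sh, tau_add, tau_ell_unit, Pi.add_apply]
  ring

lemma finrank_ne : (Module.finrank ℚ K : ℝ) ≠ 0 := by
  have := Module.finrank_pos (R := ℚ) (M := K)
  positivity

lemma sh_add_const (t : InfinitePlace K → ℝ) (c : ℝ) :
    sh (t + fun _ => c) = sh t := by
  ext v
  have := finrank_ne (K := K)
  simp only [sh, tau_add, tau_const, Pi.add_apply]
  field_simp
  ring

/-- the weight -/
noncomputable def rho (t : InfinitePlace K → ℝ) : ENNReal := G (sh t) / SU (sh t)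

lemma rho_meas : Measurable (rho : (InfinitePlace K → ℝ) → ENNReal) := by
  have := countable_units (K := K)
  have h1 : Measurable (sh : (InfinitePlace K → ℝ) → _) := by
    have := tau_meas (K := K)
    unfold sh; fun_prop
  have h2 : Measurable (SU : (InfinitePlace K → ℝ) → ENNReal) := by
    unfold SU
    refine Measurable.tsum fun u => ?_
    exact G_meas.comp (by fun_prop)
  exact (G_meas.comp h1).div (h2.comp h1)

lemma rho_sum (t : InfinitePlace K → ℝ) :
    ∑' u : (𝓞 K)ˣ, rho (t + ell ((u : 𝓞 K) : K)) = 1 := by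
  simp only [rho, sh_add_unit, SU_shift, ENNReal.div_eq_inv_mul]
  rw [ENNReal.tsum_mul_left]
  exact ENNReal.inv_mul_cancel (SU_ne_zero _) (SU_ne_top _)

lemma rho_sum_sub (t : InfinitePlace K → ℝ) :
    ∑' u : (𝓞 K)ˣ, rho (t - ell ((u : 𝓞 K) : K)) = 1 := by
  rw [← rho_sum t, ← (Equiv.inv _).tsum_eq]
  congr 1; ext u
  have : ((((Equiv.inv (𝓞 K)ˣ) u : (𝓞 K)ˣ) : 𝓞 K) : K) = ((u : 𝓞 K) : K)⁻¹ := by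
    simp
  rw [this, ell_inv, sub_neg_eq_add]

lemma rho_const (t : InfinitePlace K → ℝ) (c : ℝ) : rho (t + fun _ => c) = rho t := by
  simp only [rho, sh_add_const]

lemma sh_neg (t : InfinitePlace K → ℝ) : sh (-t) = - sh t := by
  ext v; simp [sh, tau_neg]; ring

/-- negation invariance of the weighted integral -/
lemma rho_neg (F : (InfinitePlace K → ℝ) → ENNReal) (hF : Measurable F)
    (hinv : ∀ t (u : (𝓞 K)ˣ), F (t + ell ((u : 𝓞 K) : K)) = F t) :
    ∫⁻ t, rho t * F (-t) = ∫⁻ t, rho t * F t := by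
  have := countable_units (K := K)
  rw [← lintegral_neg_eq_self (fun t => rho t * F (-t))]
  simp only [neg_neg]
  have h1 : ∀ t : InfinitePlace K → ℝ, rho (-t) * F t =
      ∑' u : (𝓞 K)ˣ, rho (-t) * (rho (t + ell ((u : 𝓞 K) : K)) * F t) := by
    intro t
    rw [ENNReal.tsum_mul_left, ENNReal.tsum_mul_right, rho_sum, one_mul]
  have h2 : ∀ t : InfinitePlace K → ℝ, rho t * F t =
      ∑' u : (𝓞 K)ˣ, rho (-t + ell ((u : 𝓞 K) : K)) * (rho t * F t) := by
    intro t
    rw [ENNReal.tsum_mul_right, rho_sum, one_mul]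
  have hr := rho_meas (K := K)
  rw [lintegral_congr h1, lintegral_congr h2, lintegral_tsum, lintegral_tsum]
  · congr 1; ext u
    conv_rhs => rw [← lintegral_add_right_eq_self _ (ell ((u : 𝓞 K) : K))]
    refine lintegral_congr fun t => ?_
    rw [hinv]
    congr 2
    abel
  · intro u; fun_prop
  · intro u; fun_prop

end DZ


namespace DZ
open MeasureTheory Real Complex Set NumberField
open scoped nonZeroDivisors
set_option linter.unusedSectionVars false

variable {K : Type} [Field K] [NumberField K]

/-- norm of a fractional ideal, as a real -/
noncomputable def fN (J : (FractionalIdeal (𝓞 K)⁰ K)ˣ) : ℝ :=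
  (FractionalIdeal.absNorm (J : FractionalIdeal (𝓞 K)⁰ K) : ℝ)

lemma fN_pos (J : (FractionalIdeal (𝓞 K)⁰ K)ˣ) : 0 < fN J := by
  unfold fN
  have h0 := FractionalIdeal.absNorm_nonneg (J : FractionalIdeal (𝓞 K)⁰ K)
  have h1 : FractionalIdeal.absNorm (J : FractionalIdeal (𝓞 K)⁰ K) ≠ 0 := by
    intro h
    exact J.ne_zero (FractionalIdeal.absNorm_eq_zero_iff.mp h)
  exact_mod_cast lt_of_le_of_ne h0 h1.symm

lemma fN_mul (J J' : (FractionalIdeal (𝓞 K)⁰ K)ˣ) : fN (J * J') = fN J * fN J' := by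
  unfold fN; push_cast; rw [map_mul]; push_cast; rfl

lemma fN_inv (J : (FractionalIdeal (𝓞 K)⁰ K)ˣ) : fN J⁻¹ = (fN J)⁻¹ := by
  have h := fN_mul J J⁻¹
  rw [mul_inv_cancel] at h
  have h1 : fN (1 : (FractionalIdeal (𝓞 K)⁰ K)ˣ) = 1 := by simp [fN]
  rw [h1] at h
  exact eq_inv_of_mul_eq_one_right h.symm

variable (K) in
/-- absolute discriminant -/
noncomputable def dd : ℝ := |(discr K : ℝ)|

lemma dd_pos : 0 < dd K := by
  unfold dd
  have := discr_ne_zero K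
  positivity

lemma dualU_eq (J : (FractionalIdeal (𝓞 K)⁰ K)ˣ) : dualU J = dualU 1 * J⁻¹ := by
  ext1
  simp only [dualU, Units.val_mk0, Units.val_mul, Units.val_one, Units.val_inv_eq_inv_val]
  exact FractionalIdeal.dual_eq_mul_inv ℤ ℚ _

lemma fN_dual_one : fN (dualU (1 : (FractionalIdeal (𝓞 K)⁰ K)ˣ)) = (dd K)⁻¹ := by
  have h := coeIdeal_differentIdeal ℤ ℚ K (𝓞 K)
  have h2 := FractionalIdeal.coeIdeal_absNorm (K := K) (differentIdeal ℤ (𝓞 K))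
  rw [absNorm_differentIdeal K, h] at h2
  have h3 : ((dualU (1 : (FractionalIdeal (𝓞 K)⁰ K)ˣ))⁻¹ : (FractionalIdeal (𝓞 K)⁰ K)ˣ) =
      (FractionalIdeal.dual ℤ ℚ (1 : FractionalIdeal (𝓞 K)⁰ K))⁻¹ := by
    simp [dualU]
  have h4 : fN ((dualU (1 : (FractionalIdeal (𝓞 K)⁰ K)ˣ))⁻¹) = dd K := by
    unfold fN dd
    rw [h3, h2]
    rw [Rat.cast_natCast, Nat.cast_natAbs, Int.cast_abs]
  rw [fN_inv] at h4
  rw [← h4, inv_inv]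

lemma fN_dual (J : (FractionalIdeal (𝓞 K)⁰ K)ˣ) : fN (dualU J) = (fN J * dd K)⁻¹ := by
  rw [dualU_eq, fN_mul, fN_inv, fN_dual_one, mul_inv, mul_comm]

/-- normalizing constant -/
noncomputable def cJ (J : (FractionalIdeal (𝓞 K)⁰ K)ˣ) : ℝ :=
  - Real.log (fN J * √(dd K)) / Module.finrank ℚ K

lemma cJ_dual (J : (FractionalIdeal (𝓞 K)⁰ K)ˣ) : cJ (dualU J) = - cJ J := by
  unfold cJ
  rw [fN_dual]
  have h1 := fN_pos J
  have h2 := dd_pos (K := K)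
  have : (fN J * dd K)⁻¹ * √(dd K) = (fN J * √(dd K))⁻¹ := by
    have h3 := Real.sqrt_pos.mpr h2
    field_simp
    exact Real.sq_sqrt h2.le
  rw [this, Real.log_inv]; ring

lemma theta_eq (J : (FractionalIdeal (𝓞 K)⁰ K)ˣ) (t : InfinitePlace K → ℝ) :
    theta J t = 1 + ∑' x : {x : Kˣ // (x : K) ∈ (J : FractionalIdeal (𝓞 K)⁰ K)},
      G (t + ell ((x : Kˣ) : K)) := by
  classical
  unfold theta
  let z : {x : K | x ∈ (J : FractionalIdeal (𝓞 K)⁰ K)} :=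
    ⟨0, FractionalIdeal.zero_mem _⟩
  rw [ENNReal.tsum_eq_add_tsum_ite z]
  congr 1
  · simp [z, Q]
  · let g : {x : Kˣ // (x : K) ∈ (J : FractionalIdeal (𝓞 K)⁰ K)} →
      {x : K | x ∈ (J : FractionalIdeal (𝓞 K)⁰ K)} := fun x => ⟨x.1, x.2⟩
    have hg : Function.Injective g := by
      intro x y h
      exact Subtype.ext (Units.ext (congrArg Subtype.val h))
    rw [← hg.tsum_eq]
    · refine tsum_congr fun x => ?_
      rw [if_neg, G_ell _ x.1.ne_zero]
      intro h
      exact x.1.ne_zero (congrArg Subtype.val h)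
    · intro x hx
      by_cases h : x = z
      · simp [h] at hx
      · refine ⟨⟨Units.mk0 x.1 (fun h' => h (Subtype.ext h')), x.2⟩, ?_⟩
        exact Subtype.ext rfl

/-- normalized theta function without constant term -/
noncomputable def th (J : (FractionalIdeal (𝓞 K)⁰ K)ˣ) (t : InfinitePlace K → ℝ) : ENNReal :=
  ∑' x : {x : Kˣ // (x : K) ∈ (J : FractionalIdeal (𝓞 K)⁰ K)},
    G (t + (fun _ => cJ J) + ell ((x : Kˣ) : K))

lemma th_fe (J : (FractionalIdeal (𝓞 K)⁰ K)ˣ) (t : InfinitePlace K → ℝ) :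
    1 + th J t = ENNReal.ofReal (Real.exp (-tau t)) * (1 + th (dualU J) (-t)) := by
  have h := theta_fe J (t + fun _ => cJ J)
  rw [theta_eq, theta_eq] at h
  have h1 : -(t + fun _ => cJ J) = -t + fun _ => cJ (dualU J) := by
    ext v; simp [cJ_dual]; ring
  rw [h1] at h
  unfold th
  rw [h]
  congr 2
  have h3 := fN_pos J
  have h4 := dd_pos (K := K)
  rw [tau_add, tau_const]
  unfold cJ
  rw [mul_div_cancel₀ _ finrank_ne, Real.exp_add, Real.exp_neg (Real.log _),
    Real.exp_log (by positivity), Real.exp_neg]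
  congr 1
  change fN J * √(dd K) * _ = _
  have h5 := Real.sqrt_pos.mpr h4
  field_simp

lemma th_meas (J : (FractionalIdeal (𝓞 K)⁰ K)ˣ) : Measurable (th J) := by
  have := countable_Kunits (K := K)
  unfold th
  refine Measurable.tsum fun x => ?_
  exact G_meas.comp (by fun_prop)

lemma th_unit (J : (FractionalIdeal (𝓞 K)⁰ K)ˣ) (t : InfinitePlace K → ℝ) (u : (𝓞 K)ˣ) :
    th J (t + ell ((u : 𝓞 K) : K)) = th J t := by
  have hmem : ∀ (w : (𝓞 K)ˣ) (x : K), x ∈ (J : FractionalIdeal (𝓞 K)⁰ K) →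
      ((w : 𝓞 K) : K) * x ∈ (J : FractionalIdeal (𝓞 K)⁰ K) := by
    intro w x hx
    have := Submodule.smul_mem (J : Submodule (𝓞 K) K) (w : 𝓞 K) hx
    rwa [Algebra.smul_def] at this
  let uK : (𝓞 K)ˣ →* Kˣ := Units.map (algebraMap (𝓞 K) K : (𝓞 K) →* K)
  let e : {x : Kˣ // (x : K) ∈ (J : FractionalIdeal (𝓞 K)⁰ K)} ≃
      {x : Kˣ // (x : K) ∈ (J : FractionalIdeal (𝓞 K)⁰ K)} :=
    { toFun := fun x => ⟨uK u * x.1, hmem u _ x.2⟩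
      invFun := fun x => ⟨uK u⁻¹ * x.1, hmem u⁻¹ _ x.2⟩
      left_inv := fun x => by ext; simp
      right_inv := fun x => by ext; simp }
  unfold th
  conv_rhs => rw [← e.tsum_eq]
  refine tsum_congr fun x => ?_
  have : ell (((e x).1 : Kˣ) : K) = ell ((u : 𝓞 K) : K) + ell ((x.1 : Kˣ) : K) := by
    rw [← ell_mul (by simp) x.1.ne_zero]
    rfl
  rw [this]
  congr 1
  abel

end DZ


namespace DZ
open MeasureTheory Real Complex Set NumberField
open scoped nonZeroDivisors
set_option linter.unusedSectionVars false

variable {K : Type} [Field K] [NumberField K]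

variable (K) in
/-- class group -/
abbrev Cl : Type := (FractionalIdeal (𝓞 K)⁰ K)ˣ ⧸ (toPrincipalIdeal (𝓞 K) K).range

variable (K) in
/-- nonzero ideals -/
abbrev Idl : Type := {I : Ideal (𝓞 K) // I ≠ ⊥}

instance : Finite (Cl K) := Finite.of_equiv _ (ClassGroup.equiv (R := 𝓞 K) K).toEquiv

/-- ideal as fractional ideal unit -/
noncomputable def idU (I : Idl K) : (FractionalIdeal (𝓞 K)⁰ K)ˣ :=
  Units.mk0 (I.1 : FractionalIdeal (𝓞 K)⁰ K) (FractionalIdeal.coeIdeal_ne_zero.mpr I.2)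

lemma idU_inj : Function.Injective (idU : Idl K → _) := by
  intro I I' h
  have := congrArg Units.val h
  exact Subtype.ext (FractionalIdeal.coeIdeal_injective this)

lemma fN_idU (I : Idl K) : fN (idU I) = (Ideal.absNorm I.1 : ℝ) := by
  simp [fN, idU, FractionalIdeal.coeIdeal_absNorm]

/-- index of theta terms -/
abbrev XJ (J : Cl K → (FractionalIdeal (𝓞 K)⁰ K)ˣ) : Type :=
  Σ C : Cl K, {x : Kˣ // (x : K) ∈ (J C : FractionalIdeal (𝓞 K)⁰ K)}

lemma exists_pi (J : (FractionalIdeal (𝓞 K)⁰ K)ˣ) (x : Kˣ)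
    (hx : (x : K) ∈ (J : FractionalIdeal (𝓞 K)⁰ K)) :
    ∃ I : Idl K, idU I * J = toPrincipalIdeal (𝓞 K) K x := by
  have h1 : ((toPrincipalIdeal (𝓞 K) K x * J⁻¹ : (FractionalIdeal (𝓞 K)⁰ K)ˣ) :
      FractionalIdeal (𝓞 K)⁰ K) ≤ 1 := by
    rw [Units.val_mul]
    have h2 : ((toPrincipalIdeal (𝓞 K) K x : (FractionalIdeal (𝓞 K)⁰ K)ˣ) :
      FractionalIdeal (𝓞 K)⁰ K) ≤ J := by
      rw [coe_toPrincipalIdeal]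
      exact FractionalIdeal.spanSingleton_le_iff_mem.mpr hx
    calc _ ≤ (J : FractionalIdeal (𝓞 K)⁰ K) * ((J⁻¹ : (FractionalIdeal (𝓞 K)⁰ K)ˣ) :
      FractionalIdeal (𝓞 K)⁰ K) := by gcongr
      _ = 1 := by simp
  obtain ⟨I, hI⟩ := FractionalIdeal.le_one_iff_exists_coeIdeal.mp h1
  have hI0 : I ≠ ⊥ := by
    rintro rfl
    exact Units.ne_zero _ (hI.symm.trans (by simp))
  refine ⟨⟨I, hI0⟩, ?_⟩
  have : idU ⟨I, hI0⟩ = toPrincipalIdeal (𝓞 K) K x * J⁻¹ := Units.ext hI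
  rw [this, inv_mul_cancel_right]

noncomputable def piJ {J : Cl K → (FractionalIdeal (𝓞 K)⁰ K)ˣ} (x : XJ J) : Idl K :=
  (exists_pi (J x.1) x.2.1 x.2.2).choose

lemma piJ_spec {J : Cl K → (FractionalIdeal (𝓞 K)⁰ K)ˣ} (x : XJ J) :
    idU (piJ x) * J x.1 = toPrincipalIdeal (𝓞 K) K x.2.1 :=
  (exists_pi (J x.1) x.2.1 x.2.2).choose_spec

lemma fN_principal (x : Kˣ) :
    fN (toPrincipalIdeal (𝓞 K) K x) = |(Algebra.norm ℚ (x : K) : ℝ)| := by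
  unfold fN
  rw [coe_toPrincipalIdeal, FractionalIdeal.absNorm_span_singleton]
  push_cast; rfl

lemma mem_of_eq (J : (FractionalIdeal (𝓞 K)⁰ K)ˣ) (I : Idl K) (x : Kˣ)
    (h : idU I * J = toPrincipalIdeal (𝓞 K) K x) : (x : K) ∈ (J : FractionalIdeal (𝓞 K)⁰ K) := by
  have h2 : ((idU I * J : (FractionalIdeal (𝓞 K)⁰ K)ˣ) : FractionalIdeal (𝓞 K)⁰ K) ≤ J := by
    rw [Units.val_mul]
    calc _ ≤ 1 * (J : FractionalIdeal (𝓞 K)⁰ K) := by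
            gcongr
            exact FractionalIdeal.coeIdeal_le_one
      _ = _ := one_mul _
  rw [h, coe_toPrincipalIdeal] at h2
  exact FractionalIdeal.spanSingleton_le_iff_mem.mp h2

lemma principal_unit (u : (𝓞 K)ˣ) :
    toPrincipalIdeal (𝓞 K) K (Units.map (algebraMap (𝓞 K) K : (𝓞 K) →* K) u) = 1 := by
  rw [toPrincipalIdeal_eq_iff]
  rw [Units.val_one, ← FractionalIdeal.spanSingleton_one,
    FractionalIdeal.spanSingleton_eq_spanSingleton]
  exact ⟨u⁻¹, by simp [Units.smul_def, Algebra.smul_def]⟩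

lemma exists_unit_of_eq (x a : Kˣ)
    (h : toPrincipalIdeal (𝓞 K) K x = toPrincipalIdeal (𝓞 K) K a) :
    ∃ u : (𝓞 K)ˣ, Units.map (algebraMap (𝓞 K) K : (𝓞 K) →* K) u * a = x := by
  have h1 := congrArg Units.val h
  rw [coe_toPrincipalIdeal, coe_toPrincipalIdeal] at h1
  obtain ⟨u, hu⟩ := FractionalIdeal.spanSingleton_eq_spanSingleton.mp h1.symm
  refine ⟨u, ?_⟩
  ext
  rw [← hu]
  simp [Units.smul_def, Algebra.smul_def]

lemma fiber_sum (J : Cl K → (FractionalIdeal (𝓞 K)⁰ K)ˣ)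
    (hJ : Function.Bijective (fun C => (QuotientGroup.mk (J C) : Cl K))) (I : Idl K)
    (t : InfinitePlace K → ℝ) :
    ∑' y : {x : XJ J // piJ x = I}, rho (t - ell ((y.1.2.1 : Kˣ) : K)) = 1 := by
  obtain ⟨C, hC⟩ := hJ.2 (QuotientGroup.mk (idU I)⁻¹)
  simp only at hC
  rw [QuotientGroup.eq] at hC
  have hC2 : idU I * J C ∈ (toPrincipalIdeal (𝓞 K) K).range := by
    have := Subgroup.inv_mem _ hC
    simpa using this
  obtain ⟨a, ha⟩ := hC2
  let uK : (𝓞 K)ˣ →* Kˣ := Units.map (algebraMap (𝓞 K) K : (𝓞 K) →* K)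
  have hua : ∀ u, idU I * J C = toPrincipalIdeal (𝓞 K) K (uK u * a) := by
    intro u
    rw [map_mul, principal_unit, one_mul, ha]
  let F : (𝓞 K)ˣ → {x : XJ J // piJ x = I} := fun u =>
    ⟨⟨C, ⟨uK u * a, mem_of_eq _ I _ (hua u)⟩⟩, by
      have h1 := piJ_spec (J := J) ⟨C, ⟨uK u * a, mem_of_eq _ I _ (hua u)⟩⟩
      rw [← hua u] at h1
      exact idU_inj (mul_right_cancel h1)⟩
  have hF : Function.Bijective F := by
    constructor
    · intro u w h
      have h1 : (F u).1 = (F w).1 := congrArg Subtype.val h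
      simp only [F, Sigma.mk.injEq, heq_eq_eq, true_and, Subtype.mk.injEq, mul_left_inj] at h1
      have h2 := congrArg Units.val h1
      exact Units.ext (RingOfIntegers.coe_injective h2)
    · rintro ⟨⟨C', x, hx⟩, hI⟩
      have h1 := piJ_spec (J := J) ⟨C', ⟨x, hx⟩⟩
      rw [hI] at h1
      simp only at h1
      have hCC : C' = C := by
        apply hJ.1
        simp only
        rw [QuotientGroup.eq]
        refine ⟨x⁻¹ * a, ?_⟩
        rw [map_mul, map_inv, ha, ← h1]
        group
      subst hCC
      rw [h1] at ha
      obtain ⟨u, hu⟩ := exists_unit_of_eq x a ha.symm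
      refine ⟨u, Subtype.ext ?_⟩
      simp only [F, Sigma.mk.injEq, heq_eq_eq, true_and]
      exact Subtype.ext hu
  rw [← (Equiv.ofBijective F hF).tsum_eq]
  rw [← rho_sum_sub (t - ell (a : K))]
  refine tsum_congr fun u => ?_
  have : ((((Equiv.ofBijective F hF) u).1.2.1 : Kˣ) : K) = ((u : 𝓞 K) : K) * a := rfl
  rw [this, ell_mul (by simp) a.ne_zero]
  congr 1
  abel

variable (K) in
/-- the key measure on the line -/
noncomputable def mm : Measure ℝ :=
  Measure.sum fun I : Idl K => Measure.map
    (fun t => tau t - Real.log ((Ideal.absNorm I.1 : ℝ) / √(dd K)))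
    ((volume : Measure (InfinitePlace K → ℝ)).withDensity G)

lemma lintegral_mm (f : ℝ → ENNReal) (hf : Measurable f) :
    ∫⁻ x, f x ∂(mm K) = ∑' I : Idl K, ∫⁻ t : InfinitePlace K → ℝ,
      G t * f (tau t - Real.log ((Ideal.absNorm I.1 : ℝ) / √(dd K))) := by
  unfold mm
  rw [lintegral_sum_measure]
  refine tsum_congr fun I => ?_
  have := tau_meas (K := K)
  rw [lintegral_map hf (by fun_prop), lintegral_withDensity_eq_lintegral_mul _ G_meas (by fun_prop)]
  rfl

theorem unfolding (J : Cl K → (FractionalIdeal (𝓞 K)⁰ K)ˣ)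
    (hJ : Function.Bijective (fun C => (QuotientGroup.mk (J C) : Cl K)))
    (f : ℝ → ENNReal) (hf : Measurable f) :
    ∑' C : Cl K, ∫⁻ t, rho t * (th (J C) t * f (tau t)) = ∫⁻ x, f x ∂(mm K) := by
  have := countable_Kunits (K := K)
  have hr := rho_meas (K := K)
  have hG := G_meas (K := K)
  have hta := tau_meas (K := K)
  have h1 : ∀ C, ∫⁻ t, rho t * (th (J C) t * f (tau t)) =
      ∑' x : {x : Kˣ // (x : K) ∈ (J C : FractionalIdeal (𝓞 K)⁰ K)},
      ∫⁻ t, rho (t - ell ((x : Kˣ) : K)) * (G t * f (tau t - Real.log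
        ((Ideal.absNorm (piJ (J := J) ⟨C, x⟩).1 : ℝ) / √(dd K)))) := by
    intro C
    have h3 : ∀ t, rho t * (th (J C) t * f (tau t)) =
        ∑' x : {x : Kˣ // (x : K) ∈ (J C : FractionalIdeal (𝓞 K)⁰ K)},
          rho t * (G (t + (fun _ => cJ (J C)) + ell ((x : Kˣ) : K)) * f (tau t)) := by
      intro t
      rw [ENNReal.tsum_mul_left, ENNReal.tsum_mul_right]
      rfl
    rw [lintegral_congr h3, lintegral_tsum (fun x => by fun_prop)]
    refine tsum_congr fun x => ?_
    rw [← lintegral_add_right_eq_self (fun t => rho (t - ell ((x : Kˣ) : K)) * (G t * f (tau t -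
      Real.log ((Ideal.absNorm (piJ (J := J) ⟨C, x⟩).1 : ℝ) / √(dd K)))))
      ((fun _ => cJ (J C)) + ell ((x : Kˣ) : K))]
    refine lintegral_congr fun t => ?_
    have e1 : t + ((fun _ => cJ (J C)) + ell ((x : Kˣ) : K)) - ell ((x : Kˣ) : K) =
      t + (fun _ => cJ (J C)) := by abel
    rw [e1, rho_const, ← add_assoc]
    congr 3
    rw [tau_add, tau_add, tau_const, tau_ell x.1.ne_zero]
    have h4 := piJ_spec (J := J) ⟨C, x⟩
    have h5 := congrArg fN h4
    rw [fN_mul, fN_principal, fN_idU] at h5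
    simp only at h5
    have h6 : 0 < (Ideal.absNorm (piJ (J := J) ⟨C, x⟩).1 : ℝ) := by
      rw [← fN_idU]; exact fN_pos _
    have h7 := fN_pos (J C)
    have h8 := Real.sqrt_pos.mpr (dd_pos (K := K))
    unfold cJ
    rw [← h5, mul_div_cancel₀ _ finrank_ne, Real.log_mul h7.ne' h8.ne', Real.log_mul h6.ne' h7.ne',
      Real.log_div h6.ne' h8.ne']
    ring
  rw [tsum_congr h1, ← ENNReal.tsum_sigma' (f := fun x : XJ J => 
      ∫⁻ t, rho (t - ell ((x.2.1 : Kˣ) : K)) * (G t * f (tau t - Real.log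
        ((Ideal.absNorm (piJ x).1 : ℝ) / √(dd K))))),
    ← (Equiv.sigmaFiberEquiv (piJ (J := J))).tsum_eq, ENNReal.tsum_sigma', lintegral_mm f hf]
  refine tsum_congr fun I => ?_
  have h2 : ∀ y : {x : XJ J // piJ x = I}, 
    ∫⁻ t, rho (t - ell ((((Equiv.sigmaFiberEquiv (piJ (J := J))) ⟨I, y⟩).2.1 : Kˣ) : K)) *
      (G t * f (tau t - Real.log
        ((Ideal.absNorm (piJ ((Equiv.sigmaFiberEquiv (piJ (J := J))) ⟨I, y⟩)).1 : ℝ) / √(dd K)))) =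
    ∫⁻ t, rho (t - ell ((y.1.2.1 : Kˣ) : K)) * (G t * f (tau t - Real.log
        ((Ideal.absNorm I.1 : ℝ) / √(dd K)))) := by
    intro y
    have : piJ ((Equiv.sigmaFiberEquiv (piJ (J := J))) ⟨I, y⟩) = I := y.2
    rw [this]
    rfl
  rw [tsum_congr h2, ← lintegral_tsum (fun x => by fun_prop)]
  refine lintegral_congr fun t => ?_
  rw [ENNReal.tsum_mul_right, fiber_sum J hJ, one_mul]

end DZ


namespace DZ
open MeasureTheory Real Complex Set NumberField
open scoped nonZeroDivisors
set_option linter.unusedSectionVars false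

lemma trans_inv (μ : Measure ℝ) [SFinite μ]
    (h : ∀ (f : ℝ → ENNReal), Measurable f → ∀ s, ∫⁻ x, f (x + s) ∂μ = ∫⁻ x, f x ∂μ)
    (f : ℝ → ENNReal) (hf : Measurable f) :
    ∫⁻ x, f x ∂μ = (∫⁻ y, (Set.Ico (0:ℝ) 1).indicator 1 (-y) ∂μ) * ∫⁻ x, f x := by
  have hi : Measurable ((Set.Ico (0:ℝ) 1).indicator (1 : ℝ → ENNReal)) :=
    measurable_one.indicator measurableSet_Ico
  calc ∫⁻ x, f x ∂μ = ∫⁻ x : ℝ, (Set.Ico (0:ℝ) 1).indicator 1 x * ∫⁻ y, f y ∂μ := by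
        rw [lintegral_mul_const _ hi, lintegral_indicator_one measurableSet_Ico]
        simp
    _ = ∫⁻ x : ℝ, ∫⁻ y, (Set.Ico (0:ℝ) 1).indicator 1 x * f (y + x) ∂μ := by
        refine lintegral_congr fun x => ?_
        rw [lintegral_const_mul _ (by fun_prop), h f hf]
    _ = ∫⁻ y, (∫⁻ x : ℝ, (Set.Ico (0:ℝ) 1).indicator 1 x * f (y + x)) ∂μ := by
        rw [lintegral_lintegral_swap]
        apply Measurable.aemeasurable
        fun_prop
    _ = ∫⁻ y, (∫⁻ x : ℝ, (Set.Ico (0:ℝ) 1).indicator 1 (x - y) * f x) ∂μ := by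
        refine lintegral_congr fun y => ?_
        rw [← lintegral_sub_right_eq_self _ y]
        simp
    _ = ∫⁻ x : ℝ, ∫⁻ y, (Set.Ico (0:ℝ) 1).indicator 1 (x - y) * f x ∂μ := by
        rw [lintegral_lintegral_swap]
        apply Measurable.aemeasurable
        fun_prop
    _ = ∫⁻ x : ℝ, (∫⁻ y, (Set.Ico (0:ℝ) 1).indicator 1 (-y) ∂μ) * f x := by
        refine lintegral_congr fun x => ?_
        rw [lintegral_mul_const _ (by fun_prop)]
        congr 1
        rw [← h (fun y => (Set.Ico (0:ℝ) 1).indicator 1 (x - y)) (by fun_prop) x]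
        refine lintegral_congr fun y => ?_
        congr 1; ring
    _ = _ := lintegral_const_mul _ hf

variable {K : Type} [Field K] [NumberField K]

variable (K) in
/-- constant of the weighted integral -/
noncomputable def c0 : ENNReal :=
  ∫⁻ y, (Set.Ico (0:ℝ) 1).indicator 1 (-y) ∂(Measure.map tau
    ((volume : Measure (InfinitePlace K → ℝ)).withDensity rho))

lemma M_tau (f : ℝ → ENNReal) (hf : Measurable f) :
    ∫⁻ t : InfinitePlace K → ℝ, rho t * f (tau t) = c0 K * ∫⁻ x, f x := by
  have hr := rho_meas (K := K)
  have hta := tau_meas (K := K)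
  have key : ∀ (f : ℝ → ENNReal), Measurable f → ∫⁻ x, f x ∂(Measure.map tau
    ((volume : Measure (InfinitePlace K → ℝ)).withDensity rho)) =
      ∫⁻ t : InfinitePlace K → ℝ, rho t * f (tau t) := by
    intro f hf
    rw [lintegral_map hf hta, lintegral_withDensity_eq_lintegral_mul _ hr (by fun_prop)]
    rfl
  rw [← key f hf]
  refine trans_inv _ ?_ f hf
  intro g hg s
  rw [key g hg, key (fun x => g (x + s)) (by fun_prop),
    ← lintegral_add_right_eq_self (fun t : InfinitePlace K → ℝ => rho t * g (tau t))
      (fun _ => s / Module.finrank ℚ K)]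
  refine lintegral_congr fun t => ?_
  rw [rho_const, tau_add, tau_const, mul_div_cancel₀ _ finrank_ne]

variable (K) in
/-- the residue constant -/
noncomputable def cc : ENNReal := ∑' _ : Cl K, c0 K

lemma out_bij : Function.Bijective
    (fun C : Cl K => (QuotientGroup.mk (Quotient.out C) : Cl K)) := by
  have : (fun C : Cl K => (QuotientGroup.mk (Quotient.out C) : Cl K)) = id := by
    ext C; exact QuotientGroup.out_eq' C
  rw [this]; exact Function.bijective_id

lemma out_bij' : Function.Bijective
    (fun C : Cl K => (QuotientGroup.mk (dualU (Quotient.out C)) : Cl K)) := by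
  have : (fun C : Cl K => (QuotientGroup.mk (dualU (Quotient.out C)) : Cl K)) =
      fun C => (QuotientGroup.mk (dualU 1) : Cl K) * C⁻¹ := by
    ext C
    rw [dualU_eq, QuotientGroup.mk_mul, QuotientGroup.mk_inv]
    congr 2
    exact QuotientGroup.out_eq' C
  rw [this]
  have h : (fun C : Cl K => (QuotientGroup.mk (dualU 1) : Cl K) * C⁻¹) =
      Equiv.divLeft (QuotientGroup.mk (dualU 1) : Cl K) := by
    ext C; simp [div_eq_mul_inv]
  rw [h]
  exact Equiv.bijective _

theorem mainB (f : ℝ → ENNReal) (hf : Measurable f) :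
    ∫⁻ x, f x ∂(mm K) + cc K * ∫⁻ x, f x =
      ∫⁻ x, ENNReal.ofReal (Real.exp x) * f (-x) ∂(mm K) +
        cc K * ∫⁻ x, ENNReal.ofReal (Real.exp (-x)) * f x := by
  have hr := rho_meas (K := K)
  have hta := tau_meas (K := K)
  have hth := fun J => th_meas (K := K) J
  rw [← unfolding _ out_bij f hf, ← unfolding _ out_bij' _ (by fun_prop)]
  unfold cc
  rw [← ENNReal.tsum_mul_right, ← ENNReal.tsum_mul_right, ← ENNReal.tsum_add, ← ENNReal.tsum_add]
  refine tsum_congr fun C => ?_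
  rw [← M_tau f hf, ← M_tau (fun x => ENNReal.ofReal (Real.exp (-x)) * f x) (by fun_prop)]
  rw [← rho_neg (fun t => th (dualU (Quotient.out C)) t *
    (ENNReal.ofReal (Real.exp (tau t)) * f (- tau t))) (by fun_prop) ?_]
  · rw [← lintegral_add_left (by fun_prop), ← lintegral_add_left]
    · refine lintegral_congr fun t => ?_
      have h := th_fe (Quotient.out C) t
      rw [tau_neg, neg_neg]
      calc _ = rho t * f (tau t) * (1 + th (Quotient.out C) t) := by ring
        _ = _ := by rw [h]; ring
    · have : Measurable (fun t : InfinitePlace K → ℝ => th (dualU (Quotient.out C)) (-t)) :=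
        (hth _).comp measurable_neg
      have h3 : Measurable (fun t : InfinitePlace K → ℝ => tau (-t)) :=
        hta.comp measurable_neg
      fun_prop
  · intro t u
    simp only [th_unit, tau_add, tau_ell_unit, add_zero]

lemma cc_le (f : ℝ → ENNReal) (hf : Measurable f) (h0 : ∀ x, -1 < x → f x = 0) :
    cc K * ∫⁻ x, f x ≤ ∫⁻ x, f x ∂(mm K) := by
  rw [← unfolding _ out_bij f hf]
  unfold cc
  rw [← ENNReal.tsum_mul_right]
  refine ENNReal.tsum_le_tsum fun C => ?_
  rw [← M_tau f hf]
  refine lintegral_mono fun t => ?_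
  rcases lt_or_ge (-1) (tau t) with h | h
  · simp [h0 _ h]
  · gcongr
    have h1 : 1 ≤ th (Quotient.out C) t := by
      have h2 : (1 : ENNReal) + 1 ≤ 1 + th (Quotient.out C) t := by
        rw [th_fe]
        calc (1 : ENNReal) + 1 = ENNReal.ofReal 2 * 1 := by simp; norm_num
          _ ≤ _ := by
            gcongr
            · have := Real.add_one_le_exp (-tau t)
              linarith
            · exact le_self_add
      exact (ENNReal.add_le_add_iff_left (by simp)).mp h2
    calc f (tau t) = 1 * f (tau t) := (one_mul _).symm
      _ ≤ _ := by gcongr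

end DZ

namespace DZ
open MeasureTheory Real Complex Set NumberField
open scoped nonZeroDivisors
set_option linter.unusedSectionVars false
variable {K : Type} [Field K] [NumberField K]

lemma tsum_fin_prod (f : ℕ → ENNReal) (n : ℕ) :
    ∑' m : Fin n → ℕ, ∏ i, f (m i) = (∑' k, f k) ^ n := by
  induction n with
  | zero => simp
  | succ n ih =>
    rw [← (Fin.consEquiv (fun _ : Fin (n + 1) => ℕ)).tsum_eq]
    rw [ENNReal.tsum_prod']
    simp only [Fin.consEquiv, Equiv.coe_fn_mk, Fin.prod_univ_succ, Fin.cons_zero, Fin.cons_succ]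
    simp_rw [ENNReal.tsum_mul_left]
    rw [ih, ENNReal.tsum_mul_right, pow_succ']

noncomputable def pr (P : Ideal (𝓞 K)) : ℕ := Ideal.absNorm (Ideal.under ℤ P)

lemma pr_prime (P : Ideal (𝓞 K)) (h : P.IsPrime) (h0 : P ≠ ⊥) : (pr P).Prime := by
  have : NeZero P := ⟨h0⟩
  exact Nat.absNorm_under_prime P

lemma pr_le (P : Ideal (𝓞 K)) (h0 : P ≠ ⊥) : pr P ≤ Ideal.absNorm P := by
  refine Nat.le_of_dvd ?_ (Int.absNorm_under_dvd_absNorm P)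
  exact Nat.pos_of_ne_zero (by rwa [Ne, Ideal.absNorm_eq_zero_iff])

set_option linter.deprecated false in
lemma exists_lab : ∃ j : Ideal (𝓞 K) → Fin (Module.finrank ℚ K),
    ∀ P P' : Ideal (𝓞 K), P.IsPrime → P ≠ ⊥ → P'.IsPrime → P' ≠ ⊥ → pr P = pr P' → j P = j P' →
      P = P' := by
  classical
  have hn : 0 < Module.finrank ℚ K := Module.finrank_pos
  have h1 : ∀ q : ℕ, ∃ g : Ideal (𝓞 K) → Fin (Module.finrank ℚ K),
      q.Prime → ∀ P P' : Ideal (𝓞 K), P.IsPrime → P ≠ ⊥ → P'.IsPrime → P' ≠ ⊥ →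
        pr P = q → pr P' = q → g P = g P' → P = P' := by
    intro q
    by_cases hq : q.Prime
    swap
    · exact ⟨fun _ => ⟨0, hn⟩, fun h => absurd h hq⟩
    have hqi := Nat.prime_iff_prime_int.mp hq
    have hq0 : Ideal.span {(q : ℤ)} ≠ ⊥ := by
      simpa using hq.ne_zero
    have hmax : (Ideal.span {(q : ℤ)}).IsMaximal := by
      have : (Ideal.span {(q : ℤ)}).IsPrime := (Ideal.span_singleton_prime (by exact_mod_cast hq.ne_zero)).2 hqi
      exact this.isMaximal hq0
    have hcard := Ideal.card_primesOverFinset_le_finrank (𝓞 K) ℚ K hq0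
    have hemb : Nonempty ((IsDedekindDomain.primesOverFinset (Ideal.span {(q : ℤ)}) (𝓞 K)) ↪
        Fin (Module.finrank ℚ K)) := by
      apply Function.Embedding.nonempty_of_card_le
      rw [Fintype.card_coe, Fintype.card_fin]
      exact hcard
    obtain ⟨e⟩ := hemb
    refine ⟨fun P => if h : P ∈ IsDedekindDomain.primesOverFinset (Ideal.span {(q : ℤ)}) (𝓞 K)
      then e ⟨P, h⟩ else ⟨0, hn⟩, fun _ P P' hP hP0 hP' hP0' h h' hg => ?_⟩
    have key : ∀ P : Ideal (𝓞 K), P.IsPrime → pr P = q →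
        P ∈ IsDedekindDomain.primesOverFinset (Ideal.span {(q : ℤ)}) (𝓞 K) := by
      intro P hP h
      rw [IsDedekindDomain.mem_primesOverFinset_iff hq0]
      refine ⟨hP, ⟨?_⟩⟩
      rw [← h]
      exact Int.ideal_span_absNorm_eq_self _
    have m1 := key P hP h
    have m2 := key P' hP' h'
    simp only [dif_pos m1, dif_pos m2] at hg
    simpa using e.injective hg
  choose g hg using h1
  refine ⟨fun P => g (pr P) P, fun P P' hP hP0 hP' hP0' h hj => ?_⟩
  have := hg (pr P) (pr_prime P hP hP0) P P' hP hP0 hP' hP0' rfl h.symm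
  apply this
  simpa [h] using hj

open Classical in
lemma euler_bound (f : ℕ → ENNReal) (hf : ∀ a b : ℕ, 0 < a → a ≤ b → f b ≤ f a)
    (hmul : ∀ a b, f (a * b) = f a * f b) (h1 : f 1 = 1) :
    ∑' I : Idl K, f (Ideal.absNorm I.1) ≤ (∑' k, f k) ^ (Module.finrank ℚ K) := by
  obtain ⟨j, hj⟩ := exists_lab (K := K)
  have hfac : ∀ I : Idl K, ∀ P ∈ UniqueFactorizationMonoid.normalizedFactors I.1,
      P.IsPrime ∧ P ≠ ⊥ := by
    intro I P hP
    have := UniqueFactorizationMonoid.prime_of_normalized_factor P hP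
    exact ⟨Ideal.isPrime_of_prime this, this.ne_zero⟩
  let m : Idl K → Fin (Module.finrank ℚ K) → ℕ := fun I i =>
    (((UniqueFactorizationMonoid.normalizedFactors I.1).filter (fun P => j P = i)).map pr).prod
  have hpr : ∀ I : Idl K, ∀ i, ∀ p ∈ ((UniqueFactorizationMonoid.normalizedFactors I.1).filter
      (fun P => j P = i)).map pr, Nat.Prime p := by
    intro I i p hp
    rw [Multiset.mem_map] at hp
    obtain ⟨P, hP, rfl⟩ := hp
    have := hfac I P (Multiset.mem_of_mem_filter hP)
    exact pr_prime P this.1 this.2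
  have hinj : Function.Injective m := by
    intro I I' h
    have h2 : (UniqueFactorizationMonoid.normalizedFactors I.1).map (fun P => (pr P, j P)) =
        (UniqueFactorizationMonoid.normalizedFactors I'.1).map (fun P => (pr P, j P)) := by
      ext ⟨q, i⟩
      have h3 := congrArg UniqueFactorizationMonoid.normalizedFactors (congrFun h i)
      simp only [m] at h3
      rw [Nat.factors_multiset_prod_of_irreducible (fun x hx => (hpr I i x hx)),
        Nat.factors_multiset_prod_of_irreducible (fun x hx => (hpr I' i x hx))] at h3
      have h4 := congrArg (Multiset.count q) h3
      simp only [Multiset.count_map, Multiset.filter_filter] at h4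
      simpa [Multiset.count_map, Prod.ext_iff, eq_comm] using h4
    let S : Set (Ideal (𝓞 K)) := {P | P.IsPrime ∧ P ≠ ⊥}
    have hS : Set.InjOn (fun P : Ideal (𝓞 K) => (pr P, j P)) S := by
      intro P hP P' hP' hh
      simp only [Prod.mk.injEq] at hh
      exact hj P P' hP.1 hP.2 hP'.1 hP'.2 hh.1 hh.2
    have h5 : ∀ I : Idl K, ((UniqueFactorizationMonoid.normalizedFactors I.1).map
        (fun P => (pr P, j P))).map (Function.invFunOn (fun P : Ideal (𝓞 K) => (pr P, j P)) S) =
        UniqueFactorizationMonoid.normalizedFactors I.1 := by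
      intro I
      rw [Multiset.map_map]
      conv_rhs => rw [← Multiset.map_id (UniqueFactorizationMonoid.normalizedFactors I.1)]
      refine Multiset.map_congr rfl fun P hP => ?_
      exact hS.leftInvOn_invFunOn (hfac I P hP)
    have h6 : UniqueFactorizationMonoid.normalizedFactors I.1 =
        UniqueFactorizationMonoid.normalizedFactors I'.1 := by
      rw [← h5 I, ← h5 I', h2]
    apply Subtype.ext
    rw [← Ideal.prod_normalizedFactors_eq_self I.2, ← Ideal.prod_normalizedFactors_eq_self I'.2, h6]
  have hprod : ∀ F : Multiset (Ideal (𝓞 K)),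
      ∏ i, ((F.filter (fun P => j P = i)).map pr).prod = (F.map pr).prod := by
    intro F
    induction F using Multiset.induction_on with
    | empty => simp
    | cons P F ih =>
      rw [Multiset.map_cons, Multiset.prod_cons, ← ih]
      have : ∀ i, (((P ::ₘ F).filter (fun P => j P = i)).map pr).prod =
          (if j P = i then pr P else 1) * ((F.filter (fun P => j P = i)).map pr).prod := by
        intro i
        by_cases h : j P = i <;> simp [h]
      simp_rw [this]
      rw [Finset.prod_mul_distrib]
      simp
  have hle : ∀ I : Idl K, f (Ideal.absNorm I.1) ≤ ∏ i, f (m I i) := by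
    intro I
    have hfp : ∀ s : Finset (Fin (Module.finrank ℚ K)), ∏ i ∈ s, f (m I i) = f (∏ i ∈ s, m I i) := by
      intro s
      induction s using Finset.induction_on with
      | empty => simp [h1]
      | insert a s ha ih => rw [Finset.prod_insert ha, Finset.prod_insert ha, ih, hmul]
    rw [hfp, hprod]
    apply hf
    · apply Nat.pos_of_ne_zero
      intro h0
      rw [Multiset.prod_eq_zero_iff, Multiset.mem_map] at h0
      obtain ⟨P, hP, h⟩ := h0
      have := hfac I P hP
      exact (pr_prime P this.1 this.2).ne_zero h
    · conv_rhs => rw [← Ideal.prod_normalizedFactors_eq_self I.2, map_multiset_prod]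
      apply Multiset.prod_map_le_prod_map
      intro P hP
      exact pr_le P (hfac I P hP).2
  calc ∑' I : Idl K, f (Ideal.absNorm I.1) ≤ ∑' I : Idl K, ∏ i, f (m I i) :=
        ENNReal.tsum_le_tsum hle
    _ ≤ ∑' m : Fin (Module.finrank ℚ K) → ℕ, ∏ i, f (m i) :=
        ENNReal.tsum_comp_le_tsum_of_injective hinj (fun m => ∏ i, f (m i))
    _ = _ := tsum_fin_prod f _

lemma zeta_two_le : ∑' I : Idl K, ENNReal.ofReal (1 / (Ideal.absNorm I.1 : ℝ) ^ 2) ≤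
    (ENNReal.ofReal (π ^ 2 / 6)) ^ (Module.finrank ℚ K) := by
  have h := euler_bound (K := K) (fun k => ENNReal.ofReal (1 / (k : ℝ) ^ 2)) ?_ ?_ ?_
  · rw [← ENNReal.ofReal_tsum_of_nonneg (fun n => by positivity) hasSum_zeta_two.summable,
      hasSum_zeta_two.tsum_eq] at h
    exact h
  · intro a b ha hab
    have : (0 : ℝ) < a := by exact_mod_cast ha
    have : (a : ℝ) ≤ b := by exact_mod_cast hab
    apply ENNReal.ofReal_le_ofReal
    gcongr
  · intro a b
    rw [← ENNReal.ofReal_mul (by positivity)]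
    congr 1
    push_cast
    rw [mul_pow]; ring
  · simp

end DZ

namespace DZ
open MeasureTheory Real Complex Set NumberField
open scoped nonZeroDivisors
set_option linter.unusedSectionVars false
variable {K : Type} [Field K] [NumberField K]

noncomputable def hg (m s x : ℝ) : ℝ := Real.exp (-π * (m * Real.exp (2 * x))) * Real.exp (s * (m * x))

lemma hg_bound (m s : ℝ) (hm : 0 < m) (hs : 0 < s) (k : ℕ) (hk : s * m < 2 * k) :
    Integrable (hg m s) ∧ ∫ x, hg m s x ≤ 1 / (s * m) + k.factorial / (π * m) ^ k / (2 * k - s * m) := by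
  have hsm : 0 < s * m := mul_pos hs hm
  have hneg : s * m - 2 * k < 0 := by linarith
  set C : ℝ := k.factorial / (π * m) ^ k with hC
  have hpm : 0 < π * m := by positivity
  have hC0 : 0 < C := by positivity
  let D : ℝ → ℝ := fun x => (Iic (0:ℝ)).indicator (fun x => Real.exp (s * m * x)) x +
    (Ioi (0:ℝ)).indicator (fun x => C * Real.exp ((s * m - 2 * k) * x)) x
  have i1 := integrableOn_exp_mul_Iic hsm 0
  have i2 := (integrableOn_exp_mul_Ioi hneg 0).const_mul C
  have j1 := i1.integrable_indicator measurableSet_Iic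
  have j2 := IntegrableOn.integrable_indicator i2 measurableSet_Ioi
  have hD : Integrable D := j1.add j2
  have hle : ∀ x, hg m s x ≤ D x := by
    intro x
    rcases le_or_gt x 0 with hx | hx
    · have : D x = Real.exp (s * m * x) := by
        simp [D, hx]
      rw [this, hg, mul_assoc]
      have h1 : Real.exp (-π * (m * Real.exp (2 * x))) ≤ 1 := by
        rw [Real.exp_le_one_iff]
        have := Real.exp_pos (2 * x)
        have : 0 < π * (m * Real.exp (2 * x)) := by positivity
        linarith
      calc _ ≤ 1 * Real.exp (s * (m * x)) := by gcongr
        _ = _ := one_mul _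
    · have : D x = C * Real.exp ((s * m - 2 * k) * x) := by
        simp [D, hx]
      rw [this, hg]
      have h1 : Real.exp (-π * (m * Real.exp (2 * x))) ≤ C * Real.exp (-(2 * k) * x) := by
        have h2 := Real.pow_div_factorial_le_exp (x := π * m * Real.exp (2 * x)) (by positivity) k
        have h3 : -π * (m * Real.exp (2 * x)) = -(π * m * Real.exp (2 * x)) := by ring
        rw [h3, Real.exp_neg]
        calc _ ≤ ((π * m * Real.exp (2 * x)) ^ k / k.factorial)⁻¹ := by
              gcongr
          _ = C * (Real.exp (2 * x) ^ k)⁻¹ := by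
              rw [hC, mul_pow]; field_simp
          _ = _ := by
              rw [← Real.exp_nat_mul, ← Real.exp_neg]; congr 2; ring
      calc _ ≤ C * Real.exp (-(2 * k) * x) * Real.exp (s * (m * x)) := by gcongr
        _ = _ := by
          rw [mul_assoc, ← Real.exp_add]; congr 2; ring
  have h0 : ∀ x, 0 ≤ hg m s x := fun x => by unfold hg; positivity
  have hintg : Integrable (hg m s) := by
    refine hD.mono' ?_ (ae_of_all _ fun x => ?_)
    · apply Continuous.aestronglyMeasurable
      unfold hg; fun_prop
    · rw [Real.norm_of_nonneg (h0 x)]; exact hle x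
  refine ⟨hintg, (integral_mono hintg hD hle).trans (le_of_eq ?_)⟩
  simp only [D]
  rw [integral_add j1 j2, integral_indicator measurableSet_Iic, integral_indicator measurableSet_Ioi,
    integral_exp_mul_Iic hsm, integral_const_mul, integral_exp_mul_Ioi hneg]
  have : (2 * k - s * m) ≠ 0 := by linarith
  have : (s * m - 2 * k) ≠ 0 := by linarith
  simp only [mul_zero, Real.exp_zero]
  congr 1
  field_simp
  ring

lemma hg_int (m s : ℝ) (hm : 0 < m) (hs : 0 < s) : Integrable (hg m s) := by
  obtain ⟨k, hk⟩ := exists_nat_gt (s * m)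
  have : 0 < s * m := mul_pos hs hm
  exact (hg_bound m s hm hs k (by linarith)).1

lemma prod_hg (s : ℝ) (t : InfinitePlace K → ℝ) :
    Real.exp (-π * Q t 1) * Real.exp (s * tau t) = ∏ v : InfinitePlace K, hg v.mult s (t v) := by
  unfold Q tau hg
  rw [Finset.prod_mul_distrib, ← Real.exp_sum, ← Real.exp_sum, ← Finset.mul_sum, ← Finset.mul_sum]
  simp

lemma mult_pos' (v : InfinitePlace K) : (0 : ℝ) < v.mult := by
  exact_mod_cast InfinitePlace.mult_pos

lemma G_int (s : ℝ) (hs : 0 < s) :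
    Integrable (fun t : InfinitePlace K → ℝ => Real.exp (-π * Q t 1) * Real.exp (s * tau t)) := by
  simp_rw [prod_hg]
  exact Integrable.fintype_prod (f := fun v : InfinitePlace K => hg v.mult s)
    (fun v => hg_int _ _ (mult_pos' v) hs)

lemma G_lint (s : ℝ) (hs : 0 < s) :
    ∫⁻ t : InfinitePlace K → ℝ, G t * ENNReal.ofReal (Real.exp (s * tau t)) =
      ENNReal.ofReal (∏ v : InfinitePlace K, ∫ x, hg v.mult s x) := by
  rw [← integral_fintype_prod_volume_eq_prod]
  rw [ofReal_integral_eq_lintegral_ofReal]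
  · refine lintegral_congr fun t => ?_
    rw [← prod_hg, ENNReal.ofReal_mul (by positivity)]; rfl
  · exact Integrable.fintype_prod (f := fun v : InfinitePlace K => hg v.mult s)
      (fun v => hg_int _ _ (mult_pos' v) hs)
  · refine ae_of_all _ fun t => ?_
    simp only [Pi.zero_apply]
    refine Finset.prod_nonneg fun v _ => ?_
    unfold hg; positivity

lemma G_two : ∫⁻ t : InfinitePlace K → ℝ, G t * ENNReal.ofReal (Real.exp (2 * tau t)) ≤ 1 := by
  rw [G_lint 2 (by norm_num)]
  rw [ENNReal.ofReal_le_one]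
  refine Finset.prod_le_one (fun v _ => integral_nonneg fun x => ?_) fun v _ => ?_
  · simp only [Pi.zero_apply]; unfold hg; positivity
  have hm : v.mult = 1 ∨ v.mult = 2 := by
    unfold InfinitePlace.mult; split_ifs <;> simp
  have hpi := Real.pi_gt_three
  rcases hm with h | h
  · rw [h]
    refine (hg_bound (1 : ℕ) 2 (by norm_num) (by norm_num) 2 (by norm_num)).2.trans ?_
    norm_num [Nat.factorial]
    have h3 : (3 : ℝ) ^ 2 ≤ π ^ 2 := by gcongr
    have : 2 / π ^ 2 ≤ 1 := by
      rw [div_le_one (by positivity)]; linarith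
    linarith
  · rw [h]
    refine (hg_bound (2 : ℕ) 2 (by norm_num) (by norm_num) 3 (by norm_num)).2.trans ?_
    norm_num [Nat.factorial]
    have h3 : (6 : ℝ) ^ 3 ≤ (π * 2) ^ 3 := by gcongr; linarith
    have : 6 / (π * 2) ^ 3 ≤ 1 := by
      rw [div_le_one (by positivity)]; linarith
    linarith

lemma exp_shift (s τ : ℝ) (I : Idl K) :
    ENNReal.ofReal (Real.exp (s * (τ - Real.log ((Ideal.absNorm I.1 : ℝ) / √(dd K))))) =
      ENNReal.ofReal (Real.exp (s * τ)) * ENNReal.ofReal ((dd K) ^ (s / 2)) *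
        ENNReal.ofReal ((Ideal.absNorm I.1 : ℝ) ^ (-s)) := by
  have hN : 0 < (Ideal.absNorm I.1 : ℝ) := by
    exact_mod_cast Nat.pos_of_ne_zero (by rw [Ne, Ideal.absNorm_eq_zero_iff]; exact I.2)
  have hd := dd_pos (K := K)
  rw [← ENNReal.ofReal_mul (by positivity), ← ENNReal.ofReal_mul (by positivity)]
  congr 1
  rw [Real.rpow_def_of_pos hd, Real.rpow_def_of_pos hN, ← Real.exp_add, ← Real.exp_add,
    Real.log_div hN.ne' (by positivity), Real.log_sqrt hd.le]
  congr 1; ring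

/-- the moment generating function of `mm` -/
lemma mm_mgf (s : ℝ) :
    ∫⁻ x, ENNReal.ofReal (Real.exp (s * x)) ∂(mm K) =
      ENNReal.ofReal ((dd K) ^ (s / 2)) *
      (∫⁻ t : InfinitePlace K → ℝ, G t * ENNReal.ofReal (Real.exp (s * tau t))) *
      ∑' I : Idl K, ENNReal.ofReal ((Ideal.absNorm I.1 : ℝ) ^ (-s)) := by
  rw [lintegral_mm _ (by fun_prop)]
  simp_rw [exp_shift]
  rw [← ENNReal.tsum_mul_left]
  refine tsum_congr fun I => ?_
  have := G_meas (K := K)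
  have h2 := tau_meas (K := K)
  rw [← lintegral_const_mul _ (by fun_prop), ← lintegral_mul_const _ (by fun_prop)]
  refine lintegral_congr fun t => ?_
  ring

lemma mm_two : ∫⁻ x, ENNReal.ofReal (Real.exp (2 * x)) ∂(mm K) ≤
    ENNReal.ofReal (dd K * (π ^ 2 / 6) ^ (Module.finrank ℚ K)) := by
  rw [mm_mgf]
  have hd := dd_pos (K := K)
  calc _ ≤ ENNReal.ofReal (dd K) * 1 * (ENNReal.ofReal (π ^ 2 / 6)) ^ (Module.finrank ℚ K) := by
        gcongr
        · simp
        · exact G_two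
        · refine le_trans (le_of_eq (tsum_congr fun I => ?_)) zeta_two_le
          congr 1
          rw [Real.rpow_neg (by positivity)]; simp
    _ = _ := by
      rw [ENNReal.ofReal_mul hd.le, ENNReal.ofReal_pow (by positivity), mul_one]

end DZ

namespace DZ
open MeasureTheory Real Complex Set NumberField
open scoped nonZeroDivisors
set_option linter.unusedSectionVars false
variable {K : Type} [Field K] [NumberField K]

lemma mm_two_lt : ∫⁻ x, ENNReal.ofReal (Real.exp (2 * x)) ∂(mm K) < ⊤ :=
  lt_of_le_of_lt mm_two ENNReal.ofReal_lt_top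

lemma mm_Ici_le (a : ℝ) : (mm K) (Ici a) ≤
    ENNReal.ofReal (Real.exp (-2 * a)) * ∫⁻ x, ENNReal.ofReal (Real.exp (2 * x)) ∂(mm K) := by
  rw [← lintegral_const_mul _ (by fun_prop), ← lintegral_indicator_one measurableSet_Ici]
  refine lintegral_mono fun x => ?_
  by_cases h : a ≤ x
  · rw [← ENNReal.ofReal_mul (by positivity), ← Real.exp_add]
    simp only [Set.indicator, mem_Ici, h, if_true, Pi.one_apply]
    rw [ENNReal.one_le_ofReal]
    apply Real.one_le_exp; linarith
  · simp [h]

lemma mm_Ici_lt (a : ℝ) : (mm K) (Ici a) < ⊤ :=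
  lt_of_le_of_lt (mm_Ici_le a) (ENNReal.mul_lt_top ENNReal.ofReal_lt_top mm_two_lt)

lemma cc_lt : cc K < ⊤ := by
  have h := cc_le (K := K) ((Icc (-2 : ℝ) (-1)).indicator 1)
    (measurable_one.indicator measurableSet_Icc) ?_
  · rw [lintegral_indicator_one measurableSet_Icc, lintegral_indicator_one measurableSet_Icc,
      Real.volume_Icc] at h
    norm_num at h
    refine lt_of_le_of_lt h (lt_of_le_of_lt (measure_mono ?_) (mm_Ici_lt (K := K) (-2)))
    exact Icc_subset_Ici_self
  · intro x hx
    apply Set.indicator_of_notMem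
    simp [hx]

lemma box_lower (A : ℝ) :
    ENNReal.ofReal (Real.exp (-π * (Module.finrank ℚ K * Real.exp (-2 * A)))) ≤
      (mm K) (Icc (-(Module.finrank ℚ K * A - Real.log (√(dd K)) + Module.finrank ℚ K))
        (-(Module.finrank ℚ K * A - Real.log (√(dd K))))) := by
  have hsum : ∑ v : InfinitePlace K, (v.mult : ℝ) = Module.finrank ℚ K := by
    exact_mod_cast InfinitePlace.sum_mult_eq
  set n : ℝ := ((Module.finrank ℚ K : ℕ) : ℝ) with hn
  set S := Icc (-(n * A - Real.log (√(dd K)) + n)) (-(n * A - Real.log (√(dd K)))) with hS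
  rw [← lintegral_indicator_one measurableSet_Icc, lintegral_mm _ (measurable_one.indicator measurableSet_Icc)]
  refine le_trans ?_ (ENNReal.le_tsum (⟨⊤, top_ne_bot⟩ : Idl K))
  have hvol : volume (Icc (fun _ : InfinitePlace K => -A - 1) (fun _ => -A)) = 1 := by
    rw [Real.volume_Icc_pi]; simp
  calc _ = ∫⁻ t in Icc (fun _ : InfinitePlace K => -A - 1) (fun _ => -A),
        ENNReal.ofReal (Real.exp (-π * (n * Real.exp (-2 * A)))) := by
        rw [setLIntegral_const, hvol, mul_one]
    _ = ∫⁻ t, (Icc (fun _ : InfinitePlace K => -A - 1) (fun _ => -A)).indicator (fun _ =>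
        ENNReal.ofReal (Real.exp (-π * (n * Real.exp (-2 * A))))) t := by
        rw [lintegral_indicator measurableSet_Icc]
    _ ≤ _ := by
      refine lintegral_mono fun t => ?_
      by_cases ht : t ∈ Icc (fun _ : InfinitePlace K => -A - 1) (fun _ => -A)
      swap
      · simp [Set.indicator_of_notMem ht]
      rw [Set.indicator_of_mem ht]
      have h1 : tau t ≤ -(n * A) := by
        unfold tau
        rw [← hsum, Finset.sum_mul, ← Finset.sum_neg_distrib]
        refine Finset.sum_le_sum fun v _ => ?_
        have h := ht.2 v
        have := mult_pos' v
        simp only at h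
        nlinarith
      have h2 : -(n * A) - n ≤ tau t := by
        unfold tau
        have : -(n * A) - n = ∑ v : InfinitePlace K, (v.mult : ℝ) * (-A - 1) := by
          rw [← Finset.sum_mul, hsum]; ring
        rw [this]
        refine Finset.sum_le_sum fun v _ => ?_
        have h := ht.1 v
        have := mult_pos' v
        exact mul_le_mul_of_nonneg_left h this.le
      have h3 : tau t - Real.log ((Ideal.absNorm (⊤ : Ideal (𝓞 K)) : ℝ) / √(dd K)) ∈ S := by
        rw [Ideal.absNorm_top, Nat.cast_one, one_div, Real.log_inv, hS]
        constructor <;> linarith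
      rw [Set.indicator_of_mem h3, Pi.one_apply, mul_one]
      unfold G
      apply ENNReal.ofReal_le_ofReal
      apply Real.exp_le_exp.2
      have h4 : Q t (1 : K) ≤ n * Real.exp (-2 * A) := by
        unfold Q
        rw [← hsum, Finset.sum_mul]
        refine Finset.sum_le_sum fun v _ => ?_
        simp only [map_one, one_pow, mul_one]
        have h := ht.2 v
        have := mult_pos' v
        simp only at h
        have h5 : Real.exp (2 * t v) ≤ Real.exp (-2 * A) := Real.exp_le_exp.2 (by linarith)
        exact mul_le_mul_of_nonneg_left h5 this.le
      have := Real.pi_pos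
      nlinarith

lemma w_lower (hK : 1 < Module.finrank ℚ K) : (5 / 4 : ℝ) ^ (Module.finrank ℚ K) ≤ √(dd K) := by
  apply Real.le_sqrt_of_sq_le
  have h := NumberField.abs_discr_ge hK
  have h' : (4 / 9 * (3 * π / 4) ^ Module.finrank ℚ K : ℝ) ≤ dd K := by
    unfold dd; exact_mod_cast h
  refine le_trans ?_ h'
  have hpi := Real.pi_gt_d2
  rw [← pow_mul, mul_comm, pow_mul]
  obtain ⟨k, hk⟩ := Nat.exists_eq_add_of_le (Nat.succ_le_of_lt hK)
  rw [hk]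
  have h1 : ((5 / 4 : ℝ) ^ 2 * (3 / 2)) ^ (Nat.succ 1 + k) ≤ (3 * π / 4) ^ (Nat.succ 1 + k) := by
    gcongr
    norm_num at hpi ⊢; linarith
  rw [mul_pow] at h1
  have h2 : (9 / 4 : ℝ) ≤ (3 / 2) ^ (Nat.succ 1 + k) := by
    rw [pow_add]
    have : (1 : ℝ) ≤ (3 / 2) ^ k := one_le_pow₀ (by norm_num)
    norm_num; linarith
  have h3 : 0 < ((5 / 4 : ℝ) ^ 2) ^ (Nat.succ 1 + k) := by positivity
  nlinarith

lemma cc_lower (hK : 1 < Module.finrank ℚ K) :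
    (10 / 11 : ℝ) ^ (Module.finrank ℚ K) ≤
      2 * Module.finrank ℚ K * (cc K).toReal * Real.exp (Module.finrank ℚ K) * √(dd K) ^ 7 := by
  have hw := w_lower hK
  have hb := fun A => box_lower (K := K) A
  have hΛ := mm_two (K := K)
  have hd := dd_pos (K := K)
  set N := Module.finrank ℚ K with hN
  set w := √(dd K) with hwd
  have hdw : dd K = w ^ 2 := by rw [hwd, Real.sq_sqrt hd.le]
  have hn0 : (0 : ℝ) < N := by positivity
  have hw1 : 1 ≤ w := le_trans (one_le_pow₀ (by norm_num)) hw
  have hw0 : 0 < w := by linarith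
  have hlog : 0 ≤ Real.log w := Real.log_nonneg hw1
  set A := 8 * Real.log w / N with hA
  specialize hb A
  have hnA : (N : ℝ) * A = 8 * Real.log w := by rw [hA]; field_simp
  rw [hnA] at hb
  set a := 8 * Real.log w - Real.log w with ha
  have ha' : a = 7 * Real.log w := by rw [ha]; ring
  set b := a + N with hb'
  have hab : a ≤ b := by rw [hb']; linarith
  have ha0 : 0 ≤ a := by rw [ha']; linarith
  -- exponentials
  have ew : Real.exp a = w ^ 7 := by
    rw [ha']
    have := Real.exp_nat_mul (Real.log w) 7
    rw [Real.exp_log hw0] at this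
    exact_mod_cast this
  have hmain := mainB (K := K) ((Icc (-b) (-a)).indicator 1)
    (measurable_one.indicator measurableSet_Icc)
  have hL : (mm K) (Icc (-b) (-a)) ≤
      ENNReal.ofReal (Real.exp (-a)) * ENNReal.ofReal (dd K * (π ^ 2 / 6) ^ N) +
      cc K * ENNReal.ofReal (Real.exp b * N) := by
    calc (mm K) (Icc (-b) (-a)) = ∫⁻ x, (Icc (-b) (-a)).indicator 1 x ∂(mm K) := by
          rw [lintegral_indicator_one measurableSet_Icc]
      _ ≤ _ := le_self_add
      _ = _ := hmain
      _ ≤ _ := by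
        gcongr
        · calc _ ≤ ∫⁻ x, ENNReal.ofReal (Real.exp (-a)) * ENNReal.ofReal (Real.exp (2 * x)) ∂(mm K) := by
                refine lintegral_mono fun x => ?_
                by_cases hx : -x ∈ Icc (-b) (-a)
                · simp only [Set.indicator_of_mem hx, Pi.one_apply, mul_one]
                  rw [← ENNReal.ofReal_mul (by positivity), ← Real.exp_add]
                  apply ENNReal.ofReal_le_ofReal
                  apply Real.exp_le_exp.2
                  linarith [hx.2]
                · simp [Set.indicator_of_notMem hx]
            _ ≤ _ := by
                rw [lintegral_const_mul _ (by fun_prop)]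
                gcongr
        · calc _ ≤ ∫⁻ x, (Icc (-b) (-a)).indicator (fun _ => ENNReal.ofReal (Real.exp b)) x := by
                refine lintegral_mono fun x => ?_
                by_cases hx : x ∈ Icc (-b) (-a)
                · simp only [Set.indicator_of_mem hx, Pi.one_apply, mul_one]
                  apply ENNReal.ofReal_le_ofReal
                  apply Real.exp_le_exp.2
                  linarith [hx.1]
                · simp [Set.indicator_of_notMem hx]
            _ = _ := by
                rw [lintegral_indicator measurableSet_Icc, setLIntegral_const, Real.volume_Icc,
                  ← ENNReal.ofReal_mul (by positivity)]
                congr 2; rw [hb']; ring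
  have hc : cc K = ENNReal.ofReal (cc K).toReal := (ENNReal.ofReal_toReal cc_lt.ne).symm
  set c := (cc K).toReal with hcdef
  have hc0 : 0 ≤ c := ENNReal.toReal_nonneg
  have hR := hb.trans hL
  rw [hc, ← ENNReal.ofReal_mul (by positivity), ← ENNReal.ofReal_mul hc0,
    ← ENNReal.ofReal_add (by positivity) (by positivity),
    ENNReal.ofReal_le_ofReal_iff (by positivity)] at hR
  -- lower bound of LHS
  have e1 : Real.exp (-2 * A) ≤ (4 / 5) ^ 16 := by
    have h1 : Real.log (5 / 4) ≤ Real.log w / N := by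
      rw [le_div_iff₀ hn0, mul_comm, ← Real.log_pow]
      exact Real.log_le_log (by positivity) hw
    have h2 : -2 * A ≤ (16 : ℕ) * (- Real.log (5 / 4)) := by
      rw [hA, mul_div_assoc]; push_cast; linarith
    calc _ ≤ _ := Real.exp_le_exp.2 h2
      _ = _ := by
        rw [Real.exp_nat_mul, Real.exp_neg, Real.exp_log (by norm_num)]; norm_num
  have e2 : (10 / 11 : ℝ) ^ N ≤ Real.exp (-π * (N * Real.exp (-2 * A))) := by
    have h1 : (10 / 11 : ℝ) ≤ Real.exp (-(1 / 11)) := by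
      have := Real.add_one_le_exp (-(1 / 11 : ℝ)); linarith
    calc (10 / 11 : ℝ) ^ N ≤ (Real.exp (-(1 / 11))) ^ N := by gcongr
      _ = Real.exp (N * (-(1 / 11))) := by rw [Real.exp_nat_mul]
      _ ≤ _ := by
        apply Real.exp_le_exp.2
        have h3 : π * Real.exp (-2 * A) ≤ 1 / 11 := by
          calc π * Real.exp (-2 * A) ≤ 3.15 * (4 / 5) ^ 16 := by
                gcongr; exact Real.pi_lt_d2.le
            _ ≤ _ := by norm_num
        nlinarith
  have e3 : Real.exp (-a) * (dd K * (π ^ 2 / 6) ^ N) ≤ 1 / 2 * (10 / 11) ^ N := by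
    rw [Real.exp_neg, ew, hdw]
    have h1 : (w ^ 7)⁻¹ * (w ^ 2 * (π ^ 2 / 6) ^ N) = (π ^ 2 / 6) ^ N / w ^ 5 := by
      field_simp
    rw [h1, div_le_iff₀ (by positivity)]
    have h2 : (π ^ 2 / 6) ≤ 1.654 := by
      have := Real.pi_lt_d2
      have := Real.pi_pos
      nlinarith
    have h3 : ((5 / 4 : ℝ) ^ 5) ^ N ≤ w ^ 5 := by
      rw [← pow_mul, mul_comm, pow_mul]; gcongr
    have h4 : (2 : ℝ) ≤ (3 / 2) ^ N := by
      calc (2 : ℝ) ≤ (3 / 2) ^ 2 := by norm_num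
        _ ≤ _ := by gcongr; · norm_num
                    · exact hK
    calc (π ^ 2 / 6) ^ N ≤ (1.654 : ℝ) ^ N := by gcongr
      _ ≤ ((2 / 3) * ((10 / 11) * (5 / 4) ^ 5)) ^ N := by gcongr; norm_num
      _ = ((3 / 2) ^ N)⁻¹ * ((10 / 11) ^ N * ((5 / 4) ^ 5) ^ N) := by
          rw [mul_pow, mul_pow, ← inv_pow]; norm_num
      _ ≤ 2⁻¹ * ((10 / 11) ^ N * w ^ 5) := by gcongr
      _ = _ := by ring
  have e4 : Real.exp b = w ^ 7 * Real.exp N := by rw [hb', Real.exp_add, ew]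
  rw [e4] at hR
  nlinarith

end DZ

namespace DZ
open MeasureTheory Real Complex Set NumberField ProbabilityTheory
open scoped nonZeroDivisors
set_option linter.unusedSectionVars false
variable {K : Type} [Field K] [NumberField K]

lemma mgf_toReal {Ω : Type*} {mΩ : MeasurableSpace Ω} (μ : Measure Ω) (X : Ω → ℝ)
    (hX : Measurable X) (s : ℝ) :
    mgf X μ s = (∫⁻ x, ENNReal.ofReal (Real.exp (s * X x)) ∂μ).toReal := by
  unfold mgf
  rw [integral_eq_lintegral_of_nonneg_ae (ae_of_all _ fun x => by positivity) (by fun_prop)]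

lemma mem_expSet {Ω : Type*} {mΩ : MeasurableSpace Ω} (μ : Measure Ω) (X : Ω → ℝ)
    (hX : Measurable X) (s : ℝ) (h : ∫⁻ x, ENNReal.ofReal (Real.exp (s * X x)) ∂μ < ⊤) :
    s ∈ integrableExpSet X μ := by
  refine ⟨by fun_prop, ?_⟩
  rw [hasFiniteIntegral_iff_ofReal (ae_of_all _ fun x => by positivity)]
  exact h

/-- the real Dirichlet series -/
noncomputable def ZZ (K : Type) [Field K] [NumberField K] (s : ℝ) : ENNReal :=
  ∑' I : Idl K, ENNReal.ofReal ((Ideal.absNorm I.1 : ℝ) ^ (-s))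

lemma absNorm_one_le (I : Idl K) : (1 : ℝ) ≤ (Ideal.absNorm I.1 : ℝ) := by
  exact_mod_cast Nat.one_le_iff_ne_zero.2 (by rw [Ne, Ideal.absNorm_eq_zero_iff]; exact I.2)

lemma ZZ_lt (s : ℝ) (hs : 2 ≤ s) : ZZ K s < ⊤ := by
  refine lt_of_le_of_lt (ENNReal.tsum_le_tsum fun I => ?_)
    (lt_of_le_of_lt zeta_two_le (ENNReal.pow_lt_top ENNReal.ofReal_lt_top) :
      ∑' I : Idl K, ENNReal.ofReal (1 / (Ideal.absNorm I.1 : ℝ) ^ 2) < ⊤)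
  apply ENNReal.ofReal_le_ofReal
  have h := absNorm_one_le I
  calc (Ideal.absNorm I.1 : ℝ) ^ (-s) ≤ (Ideal.absNorm I.1 : ℝ) ^ (-(2 : ℝ)) :=
        Real.rpow_le_rpow_of_exponent_le h (by linarith)
    _ = _ := by rw [Real.rpow_neg (by positivity)]; simp

lemma G_lint_lt (s : ℝ) (hs : 0 < s) :
    ∫⁻ t : InfinitePlace K → ℝ, G t * ENNReal.ofReal (Real.exp (s * tau t)) < ⊤ := by
  rw [G_lint s hs]; exact ENNReal.ofReal_lt_top

lemma mm_lt (s : ℝ) (hs : 2 ≤ s) : ∫⁻ x, ENNReal.ofReal (Real.exp (s * x)) ∂(mm K) < ⊤ := by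
  rw [mm_mgf]
  exact ENNReal.mul_lt_top (ENNReal.mul_lt_top ENNReal.ofReal_lt_top (G_lint_lt s (by linarith)))
    (ZZ_lt s hs)

/-- monotonicity on the half line -/
lemma mm_Ici_mono (s r : ℝ) (h : s ≤ r) (S : Set ℝ) (hS : MeasurableSet S) (hS0 : S ⊆ Ici 0) :
    ∫⁻ x in S, ENNReal.ofReal (Real.exp (s * x)) ∂(mm K) ≤
      ∫⁻ x, ENNReal.ofReal (Real.exp (r * x)) ∂(mm K) := by
  refine le_trans (setLIntegral_mono (g := fun x => ENNReal.ofReal (Real.exp (r * x)))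
    (by fun_prop) fun x hx => ?_) (setLIntegral_le_lintegral _ _)
  apply ENNReal.ofReal_le_ofReal
  apply Real.exp_le_exp.2
  exact mul_le_mul_of_nonneg_right h (hS0 hx)

lemma mm_half_lt (s : ℝ) (S : Set ℝ) (hS : MeasurableSet S) (hS0 : S ⊆ Ici 0) :
    ∫⁻ x in S, ENNReal.ofReal (Real.exp (s * x)) ∂(mm K) < ⊤ :=
  lt_of_le_of_lt (mm_Ici_mono s (max s 2) (le_max_left _ _) S hS hS0) (mm_lt _ (le_max_right _ _))

lemma expSet_half (S : Set ℝ) (hS : MeasurableSet S) (hS0 : S ⊆ Ici 0) :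
    integrableExpSet (id : ℝ → ℝ) ((mm K).restrict S) = univ :=
  eq_univ_of_forall fun s => mem_expSet _ _ measurable_id _ (mm_half_lt s S hS hS0)

noncomputable def Phi (K : Type) [Field K] [NumberField K] (s : ℂ) : ℂ :=
  complexMGF id ((mm K).restrict (Ici 0)) s + complexMGF id ((mm K).restrict (Ioi 0)) (1 - s)

noncomputable def Gam (K : Type) [Field K] [NumberField K] (s : ℂ) : ℂ :=
  complexMGF (tau : (InfinitePlace K → ℝ) → ℝ) (volume.withDensity G) s

lemma Phi_an (s : ℂ) : AnalyticAt ℂ (Phi K) s := by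
  unfold Phi
  refine AnalyticAt.add ?_ ?_
  · apply analyticAt_complexMGF
    rw [expSet_half _ measurableSet_Ici subset_rfl]; simp
  · have h : AnalyticAt ℂ (complexMGF id ((mm K).restrict (Ioi 0))) (1 - s) := by
      apply analyticAt_complexMGF
      rw [expSet_half _ measurableSet_Ioi Ioi_subset_Ici_self]; simp
    exact h.fun_comp (f := fun s : ℂ => 1 - s) (by fun_prop)

lemma Gam_lint (s : ℝ) : ∫⁻ t, ENNReal.ofReal (Real.exp (s * tau t)) ∂(volume.withDensity
    (G : (InfinitePlace K → ℝ) → ENNReal)) =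
    ∫⁻ t : InfinitePlace K → ℝ, G t * ENNReal.ofReal (Real.exp (s * tau t)) := by
  have h2 := tau_meas (K := K)
  rw [lintegral_withDensity_eq_lintegral_mul _ G_meas (by fun_prop)]
  rfl

lemma Gam_an (s : ℂ) (hs : 0 < s.re) : AnalyticAt ℂ (Gam K) s := by
  unfold Gam
  apply analyticAt_complexMGF
  have h : Ioi (0 : ℝ) ⊆ integrableExpSet (tau : (InfinitePlace K → ℝ) → ℝ) (volume.withDensity G) := by
    intro r hr
    apply mem_expSet _ _ tau_meas
    rw [Gam_lint]
    exact G_lint_lt r hr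
  exact interior_maximal h isOpen_Ioi hs

/-- the functional identity, ENNReal form -/
lemma fe_enn (s : ℝ) (hs : 2 ≤ s) :
    ∫⁻ x, ENNReal.ofReal (Real.exp (s * x)) ∂(mm K) + cc K * ENNReal.ofReal (1 / s) =
      ∫⁻ x in Ici 0, ENNReal.ofReal (Real.exp (s * x)) ∂(mm K) +
      (∫⁻ x in Ioi 0, ENNReal.ofReal (Real.exp ((1 - s) * x)) ∂(mm K) +
        cc K * ENNReal.ofReal (1 / (s - 1))) := by
  have hm := mainB (K := K) ((Iio (0:ℝ)).indicator (fun x => ENNReal.ofReal (Real.exp (s * x))))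
    (Measurable.indicator (by fun_prop) measurableSet_Iio)
  have h1 : ∀ r : ℝ, 0 < r →
      ∫⁻ x, (Iio (0:ℝ)).indicator (fun x => ENNReal.ofReal (Real.exp (r * x))) x =
      ENNReal.ofReal (1 / r) := by
    intro r hr
    rw [lintegral_indicator measurableSet_Iio, setLIntegral_congr Iio_ae_eq_Iic,
      ← ofReal_integral_eq_lintegral_ofReal (integrableOn_exp_mul_Iic hr 0)
        (ae_of_all _ fun x => by positivity), integral_exp_mul_Iic hr]
    simp
  have h2 : ∀ x : ℝ, ENNReal.ofReal (Real.exp (-x)) *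
      (Iio (0:ℝ)).indicator (fun x => ENNReal.ofReal (Real.exp (s * x))) x =
      (Iio (0:ℝ)).indicator (fun x => ENNReal.ofReal (Real.exp ((s - 1) * x))) x := by
    intro x
    by_cases hx : x ∈ Iio (0:ℝ)
    · rw [indicator_of_mem hx, indicator_of_mem hx, ← ENNReal.ofReal_mul (by positivity),
        ← Real.exp_add]
      congr 2; ring
    · rw [indicator_of_notMem hx, indicator_of_notMem hx, mul_zero]
  have h3 : ∀ x : ℝ, ENNReal.ofReal (Real.exp x) *
      (Iio (0:ℝ)).indicator (fun x => ENNReal.ofReal (Real.exp (s * x))) (-x) =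
      (Ioi (0:ℝ)).indicator (fun x => ENNReal.ofReal (Real.exp ((1 - s) * x))) x := by
    intro x
    by_cases hx : x ∈ Ioi (0:ℝ)
    · have hx' : -x ∈ Iio (0:ℝ) := by simpa using hx
      rw [indicator_of_mem hx, indicator_of_mem hx', ← ENNReal.ofReal_mul (by positivity),
        ← Real.exp_add]
      congr 2; ring
    · have hx' : -x ∉ Iio (0:ℝ) := by simpa using hx
      rw [indicator_of_notMem hx, indicator_of_notMem hx', mul_zero]
  simp_rw [h2, h3] at hm
  rw [h1 s (by linarith), h1 (s - 1) (by linarith), lintegral_indicator measurableSet_Iio,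
    lintegral_indicator measurableSet_Ioi] at hm
  rw [← hm, ← add_assoc, ← compl_Ici, lintegral_add_compl _ measurableSet_Ici]

lemma fe_real (s : ℝ) (hs : 2 ≤ s) :
    (dd K) ^ (s / 2) * mgf (tau : (InfinitePlace K → ℝ) → ℝ) (volume.withDensity G) s *
      (ZZ K s).toReal + (cc K).toReal * (1 / s) =
      mgf id ((mm K).restrict (Ici 0)) s + (mgf id ((mm K).restrict (Ioi 0)) (1 - s) +
        (cc K).toReal * (1 / (s - 1))) := by
  have h := congrArg ENNReal.toReal (fe_enn (K := K) s hs)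
  have hc := cc_lt (K := K)
  have hd := dd_pos (K := K)
  rw [ENNReal.toReal_add (mm_lt s hs).ne (ENNReal.mul_lt_top hc ENNReal.ofReal_lt_top).ne,
    ENNReal.toReal_add (mm_half_lt s _ measurableSet_Ici subset_rfl).ne
      (ENNReal.add_lt_top.2 ⟨mm_half_lt _ _ measurableSet_Ioi Ioi_subset_Ici_self,
        ENNReal.mul_lt_top hc ENNReal.ofReal_lt_top⟩).ne,
    ENNReal.toReal_add (mm_half_lt _ _ measurableSet_Ioi Ioi_subset_Ici_self).ne
      (ENNReal.mul_lt_top hc ENNReal.ofReal_lt_top).ne, mm_mgf, ENNReal.toReal_mul,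
      ENNReal.toReal_mul, ENNReal.toReal_mul, ENNReal.toReal_mul,
      ENNReal.toReal_ofReal (by positivity), ENNReal.toReal_ofReal (by positivity),
      ENNReal.toReal_ofReal (by rw [one_div, inv_nonneg]; linarith), ← Gam_lint] at h
  rw [mgf_toReal _ _ tau_meas, mgf_toReal _ _ measurable_id, mgf_toReal _ _ measurable_id]
  exact h

lemma ZZ_complex (s : ℝ) (hs : 2 ≤ s) :
    ∑' I : Idl K, (Ideal.absNorm I.1 : ℂ) ^ (-(s : ℂ)) = ((ZZ K s).toReal : ℂ) := by
  unfold ZZ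
  rw [ENNReal.tsum_toReal_eq (fun I => ENNReal.ofReal_ne_top), Complex.ofReal_tsum]
  refine tsum_congr fun I => ?_
  rw [ENNReal.toReal_ofReal (by positivity), Complex.ofReal_cpow (by positivity)]
  simp

theorem c_upper (ζ : ℂ → ℂ)
    (hζan : ∀ s : ℂ, s ≠ 1 → AnalyticAt ℂ ζ s)
    (hζeq : ∀ s : ℂ, 1 < s.re →
      ζ s = ∑' I : {I : Ideal (𝓞 K) // I ≠ ⊥}, (Ideal.absNorm I.1 : ℂ) ^ (-s))
    (β : ℝ) (hβ0 : 0 < β) (hβ1 : β < 1) (hzero : ζ β = 0) :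
    (cc K).toReal ≤ (1 - β) * (2 * (dd K * (π ^ 2 / 6) ^ Module.finrank ℚ K)) := by
  have hd := dd_pos (K := K)
  set c := (cc K).toReal with hc
  let F : ℂ → ℂ := fun s => s * (s - 1) * (Complex.exp (s * ((Real.log (dd K) / 2 : ℝ) : ℂ)) * Gam K s * ζ s)
  let H : ℂ → ℂ := fun s => s * (s - 1) * Phi K s + c
  let U1 : Set ℂ := {s | 1 < s.re}
  let U2 : Set ℂ := {s | 0 < s.re} ∩ {s | 0 < s.im}
  let U3 : Set ℂ := {s | 0 < s.re} ∩ {s | s.re < 1}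
  let U : Set ℂ := (U1 ∪ U2) ∪ U3
  have hU : IsPreconnected U := by
    have c1 : IsPreconnected U1 := (convex_halfSpace_re_gt 1).isPreconnected
    have c2 : IsPreconnected U2 :=
      ((convex_halfSpace_re_gt 0).inter (convex_halfSpace_im_gt 0)).isPreconnected
    have c3 : IsPreconnected U3 :=
      ((convex_halfSpace_re_gt 0).inter (convex_halfSpace_re_lt 1)).isPreconnected
    refine IsPreconnected.union (⟨1 / 2, 1⟩ : ℂ) (Or.inr ?_) ?_
      (IsPreconnected.union (⟨2, 1⟩ : ℂ) ?_ ?_ c1 c2) c3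
    · simp only [U2, mem_inter_iff, mem_ofPred_eq]; norm_num
    · simp only [U3, mem_inter_iff, mem_ofPred_eq]; norm_num
    · simp only [U1, mem_ofPred_eq]; norm_num
    · simp only [U2, mem_inter_iff, mem_ofPred_eq]; norm_num
  have hUre : ∀ s ∈ U, 0 < s.re ∧ s ≠ 1 := by
    rintro s ((h | h) | h)
    · simp only [U1, mem_ofPred_eq] at h
      refine ⟨by linarith, ?_⟩
      rintro rfl; simp at h
    · refine ⟨h.1, ?_⟩
      rintro rfl
      have := h.2; simp at this
    · refine ⟨h.1, ?_⟩
      rintro rfl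
      have := h.2; simp at this
  have hF : AnalyticOnNhd ℂ F U := by
    intro s hs
    obtain ⟨h1, h2⟩ := hUre s hs
    have a1 := Gam_an (K := K) s h1
    have a2 := hζan s h2
    have a3 : AnalyticAt ℂ (fun s : ℂ => Complex.exp (s * ((Real.log (dd K) / 2 : ℝ) : ℂ))) s := by
      fun_prop
    have a4 : AnalyticAt ℂ (fun s : ℂ => s * (s - 1)) s := by fun_prop
    exact a4.mul ((a3.mul a1).mul a2)
  have hH : AnalyticOnNhd ℂ H U := by
    intro s hs
    have a1 := Phi_an (K := K) s
    have a4 : AnalyticAt ℂ (fun s : ℂ => s * (s - 1)) s := by fun_prop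
    exact (a4.mul a1).add analyticAt_const
  have hreal : ∀ s : ℝ, 2 ≤ s → F s = H s := by
    intro s hs
    have hfe := fe_real (K := K) s hs
    have hz : ζ s = ((ZZ K s).toReal : ℂ) := by
      rw [hζeq s (by simp; linarith)]
      exact ZZ_complex s hs
    have he : Complex.exp ((s : ℂ) * ((Real.log (dd K) / 2 : ℝ) : ℂ)) = (((dd K) ^ (s / 2) : ℝ) : ℂ) := by
      rw [Real.rpow_def_of_pos hd]
      push_cast
      congr 1; ring
    simp only [F, H, Phi, Gam]
    have h1s : (1 : ℂ) - s = ((1 - s : ℝ) : ℂ) := by push_cast; ring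
    rw [he, hz, h1s, complexMGF_ofReal, complexMGF_ofReal, complexMGF_ofReal]
    have hs0 : s ≠ 0 := by linarith
    have hs1 : s - 1 ≠ 0 := by linarith
    set X := (dd K) ^ (s / 2) * mgf (tau : (InfinitePlace K → ℝ) → ℝ) (volume.withDensity G) s *
      (ZZ K s).toReal
    set Y := mgf id ((mm K).restrict (Ici 0)) s
    set W := mgf id ((mm K).restrict (Ioi 0)) (1 - s)
    have key : s * (s - 1) * X = s * (s - 1) * (Y + W) + c := by
      field_simp at hfe
      linarith
    exact_mod_cast key
  have hEq : EqOn F H U := by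
    refine hF.eqOn_of_preconnected_of_frequently_eq hH hU (z₀ := ((3 : ℝ) : ℂ)) ?_ ?_
    · left; left; simp only [U1, mem_ofPred_eq]; norm_num
    · have h1 : ∃ᶠ (x : ℝ) in nhdsWithin 3 {3}ᶜ, F x = H x := by
        apply Filter.Eventually.frequently
        apply Filter.Eventually.filter_mono nhdsWithin_le_nhds
        filter_upwards [Ioi_mem_nhds (show (2 : ℝ) < 3 by norm_num)] with x hx
        exact hreal x (le_of_lt hx)
      have h2 : Filter.Tendsto (fun x : ℝ => (x : ℂ)) (nhdsWithin 3 {3}ᶜ)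
          (nhdsWithin ((3 : ℝ) : ℂ) {((3 : ℝ) : ℂ)}ᶜ) := by
        refine tendsto_nhdsWithin_of_tendsto_nhds_of_eventually_within _ ?_ ?_
        · exact (Complex.continuous_ofReal.tendsto 3).mono_left nhdsWithin_le_nhds
        · filter_upwards [self_mem_nhdsWithin] with x hx
          simp only [mem_compl_iff, mem_singleton_iff] at hx ⊢
          exact_mod_cast hx
      exact h2.frequently h1
  have hβ : F β = H β := by
    apply hEq
    right
    simp only [U3, mem_inter_iff, mem_ofPred_eq, Complex.ofReal_re]
    exact ⟨hβ0, hβ1⟩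
  have hF0 : F β = 0 := by simp only [F, hzero, mul_zero]
  rw [hF0] at hβ
  simp only [H, Phi] at hβ
  have h1s : (1 : ℂ) - β = ((1 - β : ℝ) : ℂ) := by push_cast; ring
  rw [h1s, complexMGF_ofReal, complexMGF_ofReal] at hβ
  have hfin : (0 : ℝ) = β * (β - 1) * (mgf id ((mm K).restrict (Ici 0)) β +
      mgf id ((mm K).restrict (Ioi 0)) (1 - β)) + c := by exact_mod_cast hβ
  set Λ := dd K * (π ^ 2 / 6) ^ Module.finrank ℚ K with hΛ
  have hΛ0 : 0 ≤ Λ := by positivity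
  have b1 : mgf id ((mm K).restrict (Ici 0)) β ≤ Λ := by
    rw [mgf_toReal _ _ measurable_id]
    refine ENNReal.toReal_le_of_le_ofReal hΛ0 ?_
    exact (mm_Ici_mono β 2 (by linarith) _ measurableSet_Ici subset_rfl).trans mm_two
  have b2 : mgf id ((mm K).restrict (Ioi 0)) (1 - β) ≤ Λ := by
    rw [mgf_toReal _ _ measurable_id]
    refine ENNReal.toReal_le_of_le_ofReal hΛ0 ?_
    exact (mm_Ici_mono (1 - β) 2 (by linarith) _ measurableSet_Ioi Ioi_subset_Ici_self).trans mm_two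
  set Y := mgf id ((mm K).restrict (Ici 0)) β + mgf id ((mm K).restrict (Ioi 0)) (1 - β)
  have hY0 : 0 ≤ Y := add_nonneg mgf_nonneg mgf_nonneg
  have : c = β * ((1 - β) * Y) := by linarith
  rw [this]
  have h2 : 0 ≤ (1 - β) * Y := mul_nonneg (by linarith) hY0
  calc β * ((1 - β) * Y) ≤ 1 * ((1 - β) * Y) := by gcongr
    _ ≤ _ := by
      rw [one_mul]
      apply mul_le_mul_of_nonneg_left _ (by linarith)
      linarith

theorem final (hK : 1 < Module.finrank ℚ K) (β : ℝ) (hβ1 : β < 1)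
    (h : (cc K).toReal ≤ (1 - β) * (2 * (dd K * (π ^ 2 / 6) ^ Module.finrank ℚ K))) :
    1 - β ≥ (dd K) ^ (-(11.7 : ℝ)) := by
  have hd := dd_pos (K := K)
  have hw := w_lower hK
  have hl := cc_lower hK
  set N := Module.finrank ℚ K with hN
  set w := √(dd K) with hwd
  have hdw : dd K = w ^ 2 := by rw [hwd, Real.sq_sqrt hd.le]
  have hn0 : (0 : ℝ) < N := by positivity
  have hw1 : 1 ≤ w := le_trans (one_le_pow₀ (by norm_num)) hw
  have hw0 : 0 < w := by linarith
  have hb : 0 < 1 - β := by linarith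
  have e0 : (10 / 11 : ℝ) ^ N ≤ (1 - β) * (w ^ 9 * (4 * N * (Real.exp 1 * (π ^ 2 / 6)) ^ N)) := by
    refine hl.trans ?_
    rw [hdw] at h
    calc _ ≤ 2 * N * ((1 - β) * (2 * (w ^ 2 * (π ^ 2 / 6) ^ N))) * Real.exp N * w ^ 7 := by gcongr
      _ = _ := by
        have : Real.exp (N : ℝ) = Real.exp 1 ^ N := by rw [← Real.exp_nat_mul, mul_one]
        rw [this, mul_pow]; ring
  have h2 : (π ^ 2 / 6) ≤ 1.654 := by
    have := Real.pi_lt_d2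
    have := Real.pi_pos
    nlinarith
  have h3 : Real.exp 1 ≤ 2.72 := by
    have := Real.exp_one_lt_d9; norm_num at this ⊢; linarith
  have h4 : (4 * N : ℝ) ≤ 3 ^ N := by
    obtain ⟨k, hk⟩ := Nat.exists_eq_add_of_le (Nat.succ_le_of_lt hK)
    rw [hk]
    have : ∀ k : ℕ, 4 * (2 + k) ≤ 3 ^ (2 + k) := by
      intro k
      induction k with
      | zero => norm_num
      | succ k ih => rw [← add_assoc, pow_succ]; omega
    exact_mod_cast this k
  have e1 : 4 * N * (Real.exp 1 * (π ^ 2 / 6)) ^ N ≤ (10 / 11 : ℝ) ^ N * w ^ 13 := by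
    calc 4 * N * (Real.exp 1 * (π ^ 2 / 6)) ^ N ≤ 3 ^ N * (2.72 * 1.654) ^ N := by gcongr
      _ = (3 * (2.72 * 1.654)) ^ N := by rw [mul_pow 3]
      _ ≤ ((10 / 11) * (5 / 4) ^ 13) ^ N :=
          pow_le_pow_left₀ (by norm_num) (by norm_num) N
      _ = (10 / 11) ^ N * ((5 / 4) ^ N) ^ 13 := by rw [mul_pow, ← pow_mul, ← pow_mul, mul_comm 13]
      _ ≤ _ := by gcongr
  have e2 : 1 ≤ (1 - β) * w ^ 22 := by
    have hq : (0 : ℝ) < (10 / 11) ^ N := by positivity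
    have : (10 / 11 : ℝ) ^ N * 1 ≤ (10 / 11 : ℝ) ^ N * ((1 - β) * w ^ 22) := by
      calc (10 / 11 : ℝ) ^ N * 1 ≤ (1 - β) * (w ^ 9 * (4 * N * (Real.exp 1 * (π ^ 2 / 6)) ^ N)) := by
            rw [mul_one]; exact e0
        _ ≤ (1 - β) * (w ^ 9 * ((10 / 11 : ℝ) ^ N * w ^ 13)) := by gcongr
        _ = _ := by ring
    exact le_of_mul_le_mul_left this hq
  have hd1 : 1 ≤ dd K := by rw [hdw]; exact one_le_pow₀ hw1
  calc (dd K) ^ (-(11.7 : ℝ)) ≤ (dd K) ^ (-(11 : ℝ)) :=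
        Real.rpow_le_rpow_of_exponent_le hd1 (by norm_num)
    _ = (w ^ 22)⁻¹ := by
        rw [Real.rpow_neg hd.le, hdw]
        congr 1
        rw [show (11 : ℝ) = ((11 : ℕ) : ℝ) by norm_num, Real.rpow_natCast, ← pow_mul]
    _ ≤ _ := by
        rw [inv_le_iff_one_le_mul₀ (by positivity)]; exact e2

end DZ


open NumberField

/-- **Distance of a real zero of the Dedekind zeta function from 1.**
Let `L ≠ ℚ` be a number field and let `ζ` be (the analytic continuation of) its Dedekind
zeta function, i.e. `ζ` is analytic away from `s = 1` and agrees with the Dirichlet series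
`∑_{𝔞 ≠ 0} (N𝔞)^{-s}` on `Re s > 1`.  If `β₁ ∈ (0,1)` is a real zero of `ζ`, then
`1 - β₁ ≥ d_L ^ (-11.7)`. -/
theorem dedekind_zeta_real_zero_bound
    (L : Type) [Field L] [NumberField L]
    (hL : 1 < Module.finrank ℚ L)
    (ζ : ℂ → ℂ)
    (hζan : ∀ s : ℂ, s ≠ 1 → AnalyticAt ℂ ζ s)
    (hζeq : ∀ s : ℂ, 1 < s.re →
      ζ s = ∑' I : {I : Ideal (𝓞 L) // I ≠ ⊥}, (Ideal.absNorm I.1 : ℂ) ^ (-s))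
    (β₁ : ℝ) (hβ₁0 : 0 < β₁) (hβ₁1 : β₁ < 1) (hzero : ζ β₁ = 0) :
    1 - β₁ ≥ (|(NumberField.discr L : ℝ)|) ^ (-(11.7 : ℝ)) := by
  exact DZ.final (K := L) hL β₁ hβ₁1 (DZ.c_upper ζ hζan hζeq β₁ hβ₁0 hβ₁1 hzero)
end

section
/- Let T₀ ≥ 0 and let s = σ + it with σ > 0 and |t| ≤ T₀. Define g(σ,T₀) = max_{|u| ≤ T₀} ( log( √(σ² + u²) / (|u| + 2) ) − σ/(σ² + u²) ) + 1/(3σ²) − log 2. Then Re( (Γ'/Γ)(s/2) ) ≤ log(|t| + 2) + g(σ,T₀), where Γ is the complex Gamma function and Γ'/Γ is its logarithmic derivative. -/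
open Real

section helpers
open Filter Topology MeasureTheory Set

lemma aux_norm_Gamma_le {w : ℂ} (hw : 0 < w.re) : ‖Complex.Gamma w‖ ≤ Real.Gamma w.re := by
  rw [Complex.Gamma_eq_integral hw, Complex.GammaIntegral, Real.Gamma_eq_integral hw]
  refine (norm_integral_le_integral_norm _).trans (le_of_eq ?_)
  refine setIntegral_congr_fun measurableSet_Ioi ?_
  intro x hx
  have hx : 0 < x := hx
  simp only [norm_mul]
  rw [Complex.norm_cpow_eq_rpow_re_of_pos hx, Complex.norm_real]
  simp [abs_of_pos (Real.exp_pos _)]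

lemma aux_deriv_tendsto {f : ℕ → ℂ → ℂ} {z : ℂ} {r C : ℝ} {U : Set ℂ} (hU : IsOpen U) (hr : 0 < r)
    (hUr : Metric.closedBall z r ⊆ U)
    (hf : ∀ᶠ n in atTop, DifferentiableOn ℂ (f n) U)
    (hC : ∀ᶠ n in atTop, ∀ w ∈ Metric.sphere z r, ‖f n w‖ ≤ C)
    (hlim : ∀ w ∈ Metric.sphere z r, Tendsto (fun n => f n w) atTop (𝓝 1)) :
    Tendsto (fun n => deriv (f n) z) atTop (𝓝 0) := by
  have key : ∀ g : ℂ → ℂ, DifferentiableOn ℂ g U → deriv g z =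
      ((2 * π * Complex.I : ℂ)⁻¹ • ∮ w in C(z, r), ((w - z) ^ 2)⁻¹ • g w) := fun g hg =>
    (Complex.two_pi_I_inv_smul_circleIntegral_sub_sq_inv_smul_of_differentiable hU hUr hg
      (Metric.mem_ball_self hr)).symm
  have h1 := key (fun _ => 1) (differentiableOn_const _)
  rw [deriv_const] at h1
  have h2 : Tendsto (fun n => ((2 * π * Complex.I : ℂ)⁻¹ • ∮ w in C(z, r), ((w - z) ^ 2)⁻¹ • f n w))
      atTop (𝓝 0) := by
    rw [h1]
    refine Tendsto.const_smul ?_ _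
    unfold circleIntegral
    refine intervalIntegral.tendsto_integral_filter_of_dominated_convergence
      (fun _ => r * ((r ^ 2)⁻¹ * C)) ?_ ?_ ?_ ?_
    · filter_upwards [hf] with n hn
      refine Continuous.aestronglyMeasurable ?_
      have hc : Continuous fun θ => f n (circleMap z r θ) :=
        hn.continuousOn.comp_continuous (continuous_circleMap z r)
          (fun θ => hUr (circleMap_mem_closedBall z hr.le θ))
      have hd : Continuous fun θ => ((circleMap z r θ - z) ^ 2)⁻¹ :=
        (((continuous_circleMap z r).sub continuous_const).pow 2).inv₀
          (fun θ => pow_ne_zero 2 (sub_ne_zero.2 (circleMap_ne_center hr.ne')))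
      simp only [deriv_circleMap]
      exact ((continuous_circleMap 0 r).mul continuous_const).smul (hd.smul hc)
    · filter_upwards [hC] with n hn
      refine Eventually.of_forall fun θ _ => ?_
      have := hn _ (circleMap_mem_sphere z hr.le θ)
      have e : ‖circleMap z r θ - z‖ = r := by
        have := circleMap_mem_sphere z hr.le θ
        rwa [mem_sphere_iff_norm] at this
      rw [norm_smul, norm_smul, norm_inv, norm_pow, e, deriv_circleMap]
      simp only [norm_mul, norm_circleMap_zero, Complex.norm_I, abs_of_pos hr, mul_one]
      gcongr
    · simp
    · refine Eventually.of_forall fun θ _ => ?_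
      exact ((hlim _ (circleMap_mem_sphere z hr.le θ)).const_smul _).const_smul _
  refine h2.congr' ?_
  filter_upwards [hf] with n hn
  exact (key _ hn).symm

/-- the normalised quotient -/
noncomputable def auxF (n : ℕ) (w : ℂ) : ℂ :=
  Complex.Gamma (w + n + 1) / ((n.factorial : ℂ) * (n : ℂ) ^ w)

lemma aux_ne {w : ℂ} (hw : 0 < w.re) (m : ℕ) : w ≠ -m := by
  rintro rfl
  simp at hw
  have : (0:ℝ) ≤ m := m.cast_nonneg
  linarith

lemma aux_Gamma_shift {w : ℂ} (hw : 0 < w.re) (n : ℕ) :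
    Complex.Gamma (w + n + 1) = Complex.Gamma w * ∏ j ∈ Finset.range (n + 1), (w + j) := by
  induction n with
  | zero => simp [Complex.Gamma_add_one w (by simpa using aux_ne hw 0), mul_comm]
  | succ n ih =>
    rw [Finset.prod_range_succ, ← mul_assoc, ← ih]
    have : w + (n + 1 : ℕ) ≠ 0 := fun h => aux_ne hw (n + 1) (eq_neg_of_add_eq_zero_left h)
    rw [Complex.Gamma_add_one _ this]
    push_cast
    rw [mul_comm, add_assoc]

lemma auxF_eq {w : ℂ} (hw : 0 < w.re) (n : ℕ) :
    auxF n w = Complex.Gamma w / Complex.GammaSeq w n := by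
  rw [auxF, aux_Gamma_shift hw, Complex.GammaSeq, div_div_eq_mul_div]
  ring

lemma auxF_tendsto {w : ℂ} (hw : 0 < w.re) : Tendsto (fun n => auxF n w) atTop (𝓝 1) := by
  have h0 : Complex.Gamma w ≠ 0 := Complex.Gamma_ne_zero_of_re_pos hw
  have := (tendsto_const_nhds (x := Complex.Gamma w)).div (Complex.GammaSeq_tendsto_Gamma w) h0
  rw [div_self h0] at this
  exact this.congr fun n => (auxF_eq hw n).symm

lemma auxF_norm_real {x : ℝ} (hx : 0 < x) {n : ℕ} (hn : 0 < n) :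
    ‖auxF n x‖ = Real.exp (Real.log (Real.Gamma (x + n + 1)) - Real.log n.factorial
      - x * Real.log n) := by
  have hn' : (0:ℝ) < n := by exact_mod_cast hn
  have h1 : 0 < Real.Gamma (x + n + 1) := Real.Gamma_pos_of_pos (by positivity)
  rw [auxF, show ((x:ℂ) + n + 1) = ((x + n + 1 : ℝ) : ℂ) by push_cast; rfl, Complex.Gamma_ofReal,
    Real.exp_sub, Real.exp_sub, Real.exp_log h1, Real.exp_log (by positivity), norm_div, norm_mul,
    Complex.norm_real, Real.norm_of_nonneg h1.le]
  rw [show (n:ℂ) = ((n:ℝ):ℂ) by simp, Complex.norm_cpow_eq_rpow_re_of_pos hn',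
    Real.rpow_def_of_pos hn', Complex.ofReal_re, div_div, mul_comm (Real.log _)]
  simp

lemma auxF_norm_le {w : ℂ} {n : ℕ} (hn : 0 < n) (hw : 0 < w.re) : ‖auxF n w‖ ≤ ‖auxF n w.re‖ := by
  have hn' : (0:ℝ) < n := by exact_mod_cast hn
  have h1 : 0 < Real.Gamma (w.re + n + 1) := Real.Gamma_pos_of_pos (by positivity)
  rw [auxF, auxF, show ((w.re:ℂ) + n + 1) = ((w.re + n + 1 : ℝ) : ℂ) by push_cast; rfl,
    Complex.Gamma_ofReal, norm_div, norm_div, norm_mul, norm_mul, Complex.norm_real,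
    Real.norm_of_nonneg h1.le, show (n:ℂ) = ((n:ℝ):ℂ) by simp,
    Complex.norm_cpow_eq_rpow_re_of_pos hn', Complex.norm_cpow_eq_rpow_re_of_pos hn',
    Complex.ofReal_re]
  gcongr
  have := aux_norm_Gamma_le (w := w + n + 1) (by simp; positivity)
  simpa using this

lemma auxF_norm_le_max {a b : ℝ} (ha : 0 < a) {w : ℂ} (hw : w.re ∈ Icc a b) {n : ℕ} (hn : 0 < n) :
    ‖auxF n w‖ ≤ max ‖auxF n a‖ ‖auxF n b‖ := by
  have hw0 : 0 < w.re := ha.trans_le hw.1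
  have hb0 : 0 < b := hw0.trans_le hw.2
  refine (auxF_norm_le hn hw0).trans ?_
  rw [auxF_norm_real hw0 hn, auxF_norm_real ha hn, auxF_norm_real hb0 hn,
    ← Real.exp_monotone.map_max]
  refine Real.exp_monotone ?_
  have hconv : ConvexOn ℝ (Ioi (0:ℝ)) (fun x : ℝ => Real.log (Real.Gamma (x + n + 1))
      - Real.log n.factorial - x * Real.log n) := by
    refine ⟨convex_Ioi 0, ?_⟩
    intro x hx y hy p q hp hq hpq
    have hx : 0 < x := hx
    have hy : 0 < y := hy
    have := Real.convexOn_log_Gamma.2 (x := x + n + 1) (by simp; positivity)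
      (y := y + n + 1) (by simp; positivity) hp hq hpq
    simp only [smul_eq_mul, Function.comp] at this ⊢
    have e : p * x + q * y + n + 1 = p * (x + n + 1) + q * (y + n + 1) := by
      linear_combination -(n + 1 : ℝ) * hpq
    rw [e]
    have e2 : Real.log n.factorial = (p + q) * Real.log n.factorial := by rw [hpq, one_mul]
    linarith
  exact hconv.le_max_of_mem_Icc ha hb0 hw

lemma auxF_hasDerivAt {w : ℂ} (hw : 0 < w.re) {n : ℕ} (hn : 0 < n) :
    HasDerivAt (auxF n) (auxF n w * (Complex.digamma (w + n + 1) - Complex.log n)) w := by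
  have hn' : (n : ℂ) ≠ 0 := by exact_mod_cast hn.ne'
  have hre : 0 < (w + n + 1).re := by simp; positivity
  have hG : HasDerivAt (fun w : ℂ => Complex.Gamma (w + n + 1))
      (deriv Complex.Gamma (w + n + 1)) w := by
    have := (Complex.differentiableAt_Gamma _ (aux_ne hre)).hasDerivAt
    rw [add_assoc] at this
    simpa only [add_assoc] using this.comp_add_const w _
  have hP : HasDerivAt (fun w : ℂ => (n.factorial : ℂ) * (n : ℂ) ^ w)
      ((n.factorial : ℂ) * ((n : ℂ) ^ w * Complex.log n * 1)) w :=
    ((hasDerivAt_id w).const_cpow (Or.inl hn')).const_mul _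
  have hF : (n.factorial : ℂ) ≠ 0 := by exact_mod_cast n.factorial_ne_zero
  have hpow : (n : ℂ) ^ w ≠ 0 := by simp [Complex.cpow_eq_zero_iff, hn']
  have h0 : Complex.Gamma (w + n + 1) ≠ 0 := Complex.Gamma_ne_zero_of_re_pos hre
  have := hG.div hP (mul_ne_zero hF hpow)
  refine this.congr_deriv ?_
  rw [auxF, Complex.digamma_def, logDeriv_apply]
  field_simp

lemma aux_digamma_tendsto {z : ℂ} (hz : 0 < z.re) :
    Tendsto (fun n : ℕ => Complex.digamma (z + n + 1) - Complex.log n) atTop (𝓝 0) := by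
  have hr : 0 < z.re / 2 := by positivity
  have hre : ∀ w ∈ Metric.closedBall z (z.re / 2), w.re ∈ Icc (z.re / 2) (3 * z.re / 2) := by
    intro w hw
    rw [mem_closedBall_iff_norm] at hw
    have := (Complex.abs_re_le_norm (w - z)).trans hw
    rw [Complex.sub_re, abs_le] at this
    constructor <;> linarith
  have ha := (auxF_tendsto (w := ((z.re / 2 : ℝ) : ℂ)) (by simpa using hz)).norm
  have hb := (auxF_tendsto (w := ((3 * z.re / 2 : ℝ) : ℂ))
    (by rw [Complex.ofReal_re]; positivity)).norm
  rw [norm_one] at ha hb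
  have hd : Tendsto (fun n => deriv (auxF n) z) atTop (𝓝 0) := by
    refine aux_deriv_tendsto (C := 2) (U := {w : ℂ | 0 < w.re})
      (isOpen_lt continuous_const Complex.continuous_re) hr ?_ ?_ ?_ ?_
    · intro w hw
      exact hr.trans_le (hre w hw).1
    · filter_upwards [eventually_gt_atTop 0] with n hn w hw
      exact (auxF_hasDerivAt hw hn).differentiableAt.differentiableWithinAt
    · filter_upwards [eventually_gt_atTop 0, ha.eventually_le_const one_lt_two,
        hb.eventually_le_const one_lt_two] with n hn h1 h2 w hw
      exact (auxF_norm_le_max hr (hre w (Metric.sphere_subset_closedBall hw)) hn).trans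
        (max_le h1 h2)
    · intro w hw
      exact auxF_tendsto (hr.trans_le (hre w (Metric.sphere_subset_closedBall hw)).1)
  have := hd.div (auxF_tendsto hz) one_ne_zero
  rw [zero_div] at this
  refine this.congr' ?_
  filter_upwards [eventually_gt_atTop 0,
    (auxF_tendsto hz).eventually_ne one_ne_zero] with n hn h0
  simp only [Pi.div_apply]
  rw [(auxF_hasDerivAt hz hn).deriv]
  rw [mul_div_cancel_left₀ _ h0]

noncomputable def auxH (z : ℂ) : ℂ :=
  (z⁻¹ + (z + 1)⁻¹) / 2 - (Complex.log (z + 1) - Complex.log z)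

lemma auxH_hasDerivAt {z : ℂ} (hz : 0 < z.re) :
    HasDerivAt auxH (-(1 / (2 * z ^ 2 * (z + 1) ^ 2))) z := by
  have h1 : 0 < (z + 1).re := by simp; positivity
  have z0 : z ≠ 0 := by rintro rfl; simp at hz
  have z1 : z + 1 ≠ 0 := by intro h; rw [h] at h1; simp at h1
  have a1 := hasDerivAt_inv z0
  have a2 := (hasDerivAt_inv z1).comp_add_const z 1
  have a3 := (Complex.hasDerivAt_log (z := z) (Or.inl hz))
  have a4 := (Complex.hasDerivAt_log (z := z + 1) (Or.inl h1)).comp_add_const z 1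
  refine (((a1.add a2).div_const 2).sub (a4.sub a3)).congr_deriv ?_
  field_simp
  ring

/-- `log ‖z + n + c‖ - log n → 0`. -/
lemma aux_log_tendsto (z : ℂ) :
    Tendsto (fun n : ℕ => Real.log ‖z + n‖ - Real.log n) atTop (𝓝 0) := by
  have h : Tendsto (fun n : ℕ => Real.log ‖z / n + 1‖) atTop (𝓝 0) := by
    have h1 : Tendsto (fun n : ℕ => z / n) atTop (𝓝 0) :=
      tendsto_const_div_atTop_nhds_zero_nat z
    have h2 := ((h1.add_const 1).norm).log (by simp)
    simpa using h2
  refine h.congr' ?_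
  have h3 : Tendsto (fun n : ℕ => z / n + 1) atTop (𝓝 1) := by
    simpa using (tendsto_const_div_atTop_nhds_zero_nat z).add_const 1
  filter_upwards [eventually_gt_atTop 0, h3.eventually_ne one_ne_zero] with n hn h0
  have hn' : (n : ℂ) ≠ 0 := by exact_mod_cast hn.ne'
  have e : z + n = (z / n + 1) * n := by field_simp
  rw [e, norm_mul, Real.log_mul (by simpa using h0) (by simpa using hn.ne')]
  simp

lemma aux_inv_tendsto (z : ℂ) : Tendsto (fun n : ℕ => (z + n)⁻¹) atTop (𝓝 0) := by
  refine tendsto_inv₀_cobounded.comp ?_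
  rw [← tendsto_norm_atTop_iff_cobounded]
  refine tendsto_atTop_mono (f := fun n : ℕ => (n : ℝ) - ‖z‖) ?_ 
    (tendsto_atTop_add_const_right _ _ tendsto_natCast_atTop_atTop)
  intro n
  have := norm_sub_le (z + n) z
  simp at this
  linarith

lemma auxH_re (z : ℂ) : (auxH z).re =
    ((z⁻¹).re + ((z + 1)⁻¹).re) / 2 - (Real.log ‖z + 1‖ - Real.log ‖z‖) := by
  rw [auxH, Complex.sub_re, Complex.sub_re, Complex.log_re, Complex.log_re, Complex.div_ofNat_re,
    Complex.add_re]

lemma auxH_tendsto (z : ℂ) : Tendsto (fun n : ℕ => (auxH (z + n)).re) atTop (𝓝 0) := by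
  have a := (Complex.continuous_re.tendsto _).comp (aux_inv_tendsto z)
  have b := (Complex.continuous_re.tendsto _).comp (aux_inv_tendsto (z + 1))
  have c := aux_log_tendsto z
  have d := aux_log_tendsto (z + 1)
  have := ((a.add b).div_const 2).sub (d.sub c)
  simp only [Complex.zero_re, add_zero, zero_div, sub_zero] at this
  refine this.congr fun n => ?_
  rw [auxH_re, show z + n + 1 = z + 1 + n by ring]
  simp

lemma aux_sq_tendsto (x : ℝ) : Tendsto (fun n : ℕ => 1 / (x + n) ^ 2) atTop (𝓝 0) := by
  have h : Tendsto (fun n : ℕ => x + n) atTop atTop :=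
    tendsto_atTop_add_const_left _ _ tendsto_natCast_atTop_atTop
  simpa [Function.comp_def] using tendsto_inv_atTop_zero.comp ((tendsto_pow_atTop two_ne_zero).comp h)

lemma auxH_bound {z : ℂ} (hz : 0 < z.re) :
    0 ≤ (auxH z).re + (1 / 12) * (1 / z.re ^ 2 - 1 / (z.re + 1) ^ 2) := by
  set y := z.im
  set G : ℝ → ℝ := fun x =>
    (auxH (x + y * Complex.I)).re + (1 / 12) * (1 / x ^ 2 - 1 / (x + 1) ^ 2) with hG
  have hder : ∀ x : ℝ, 0 < x → HasDerivAt G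
      ((-(1 / (2 * (x + y * Complex.I) ^ 2 * ((x + y * Complex.I) + 1) ^ 2)) : ℂ).re
        + (1 / 12) * (-2 / x ^ 3 + 2 / (x + 1) ^ 3)) x := by
    intro x hx
    have h1 : HasDerivAt (fun w : ℂ => auxH (w + y * Complex.I)) _ (x : ℂ) :=
      (auxH_hasDerivAt (z := x + y * Complex.I) (by simpa using hx)).comp_add_const (x:ℂ) _
    have h0 : ∀ x : ℝ, 0 < x → HasDerivAt (fun x : ℝ => 1 / x ^ 2) (-2 / x ^ 3) x := by
      intro x hx
      refine ((hasDerivAt_const x (1:ℝ)).div (hasDerivAt_pow 2 x) (by positivity)).congr_deriv ?_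
      field_simp
      norm_num
      ring
    have h2 := h0 x hx
    have h3 : HasDerivAt (fun x : ℝ => 1 / (x + 1) ^ 2) (-2 / (x + 1) ^ 3) x :=
      (h0 (x + 1) (by linarith)).comp_add_const x 1
    refine (h1.real_of_complex.add ((h2.sub h3).const_mul (1 / 12))).congr_deriv ?_
    ring
  have hanti : AntitoneOn G (Ioi 0) := by
    refine antitoneOn_of_deriv_nonpos (convex_Ioi 0)
      (fun x hx => (hder x hx).continuousAt.continuousWithinAt)
      (fun x hx => (hder x (interior_subset hx)).differentiableAt.differentiableWithinAt) ?_
    intro x hx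
    have hx : 0 < x := interior_subset hx
    rw [(hder x hx).deriv]
    set w : ℂ := x + y * Complex.I with hw
    have w0 : x ≤ ‖w‖ := by
      have := Complex.re_le_norm w
      simpa [hw] using this
    have w1 : x + 1 ≤ ‖w + 1‖ := by
      have := Complex.re_le_norm (w + 1)
      simpa [hw] using this
    have b1 : (-(1 / (2 * w ^ 2 * (w + 1) ^ 2)) : ℂ).re ≤ 1 / (2 * x ^ 2 * (x + 1) ^ 2) := by
      refine (Complex.re_le_norm _).trans ?_
      rw [norm_neg, norm_div, norm_mul, norm_mul, norm_pow, norm_pow, norm_one, Complex.norm_ofNat]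
      gcongr
    have b2 : 1 / (2 * x ^ 2 * (x + 1) ^ 2) + (1 / 12) * (-2 / x ^ 3 + 2 / (x + 1) ^ 3)
        = - (1 / (6 * x ^ 3 * (x + 1) ^ 3)) := by
      field_simp
      ring
    have b3 : 0 < 1 / (6 * x ^ 3 * (x + 1) ^ 3) := by positivity
    linarith
  have hlim : Tendsto (fun n : ℕ => G (z.re + n)) atTop (𝓝 0) := by
    have := (auxH_tendsto z).add
      (((aux_sq_tendsto z.re).sub (aux_sq_tendsto (z.re + 1))).const_mul (1 / 12))
    simp only [sub_zero, mul_zero, add_zero] at this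
    refine this.congr fun n => ?_
    have e : ((z.re + n : ℝ) : ℂ) + y * Complex.I = z + n := by
      conv_rhs => rw [← Complex.re_add_im z]
      push_cast; ring
    simp only [hG]
    rw [e, show z.re + n + 1 = z.re + 1 + n by ring]
  have hfin : 0 ≤ G z.re := by
    refine le_of_tendsto' hlim fun n => ?_
    have : (0:ℝ) ≤ n := n.cast_nonneg
    exact hanti hz (show 0 < z.re + n by linarith) (by linarith)
  simpa only [hG, y, Complex.re_add_im] using hfin

noncomputable def auxK (z : ℂ) : ℝ :=
  (Complex.digamma z).re - Real.log ‖z‖ + (z⁻¹).re / 2 - (1 / 12) * (1 / z.re ^ 2)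

lemma auxK_step {z : ℂ} (hz : 0 < z.re) : auxK z ≤ auxK (z + 1) := by
  have := auxH_bound hz
  rw [auxH_re] at this
  rw [auxK, auxK, Complex.digamma_apply_add_one z (aux_ne hz), Complex.add_re, Complex.add_re,
    Complex.one_re]
  linarith

lemma auxK_le {z : ℂ} (hz : 0 < z.re) (n : ℕ) : auxK z ≤ auxK (z + n) := by
  induction n with
  | zero => simp
  | succ n ih =>
    refine ih.trans ?_
    have := auxK_step (z := z + n) (by simp; positivity)
    rwa [add_assoc, ← Nat.cast_succ] at this

lemma auxK_nonpos {z : ℂ} (hz : 0 < z.re) : auxK z ≤ 0 := by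
  have a := (Complex.continuous_re.tendsto _).comp (aux_digamma_tendsto hz)
  have b := aux_log_tendsto (z + 1)
  have c := (Complex.continuous_re.tendsto _).comp (aux_inv_tendsto (z + 1))
  have d := aux_sq_tendsto (z.re + 1)
  have := ((a.sub b).add (c.div_const 2)).sub (d.const_mul (1 / 12))
  simp only [Complex.zero_re, zero_div, sub_zero, mul_zero, add_zero] at this
  refine ge_of_tendsto' this fun n => ?_
  refine (auxK_le hz (n + 1)).trans (le_of_eq ?_)
  have e1 : z + (n + 1 : ℕ) = z + n + 1 := by push_cast; ring
  have e2 : z + 1 + n = z + n + 1 := by ring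
  have e3 : z.re + 1 + n = (z + n + 1).re := by simp; ring
  have e4 : (Complex.log n).re = Real.log n := by rw [Complex.log_re]; simp
  simp only [Function.comp]
  rw [auxK, e1, e2, e3, Complex.sub_re, e4]
  ring

end helpers

/-- **A bound for the real part of the digamma function.**
Let `T₀ ≥ 0` and `s = σ + it` with `σ > 0` and `|t| ≤ T₀`.  With
`g(σ,T₀) = max_{|u| ≤ T₀} (log(√(σ²+u²)/(|u|+2)) − σ/(σ²+u²)) + 1/(3σ²) − log 2`,
one has `Re((Γ'/Γ)(s/2)) ≤ log(|t|+2) + g(σ,T₀)`. -/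
theorem digamma_real_part_bound
    (T₀ : ℝ) (hT₀ : 0 ≤ T₀) (σ t : ℝ) (hσ : 0 < σ) (ht : |t| ≤ T₀) :
    (deriv Complex.Gamma ((σ + t * Complex.I) / 2) /
        Complex.Gamma ((σ + t * Complex.I) / 2)).re ≤
      Real.log (|t| + 2) +
        ((⨆ u : {u : ℝ // |u| ≤ T₀},
            (Real.log (Real.sqrt (σ ^ 2 + (u : ℝ) ^ 2) / (|(u : ℝ)| + 2)) -
              σ / (σ ^ 2 + (u : ℝ) ^ 2))) +
          1 / (3 * σ ^ 2) - Real.log 2) := by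
  set z : ℂ := (σ + t * Complex.I) / 2 with hz
  have hre : z.re = σ / 2 := by simp [hz]
  have him : z.im = t / 2 := by simp [hz]
  have hpos : 0 < σ ^ 2 + t ^ 2 := by positivity
  have hK := auxK_nonpos (z := z) (by rw [hre]; positivity)
  have hnorm : ‖z‖ = Real.sqrt (σ ^ 2 + t ^ 2) / 2 := by
    rw [hz, norm_div, Complex.norm_add_mul_I, Complex.norm_ofNat]
  have hinv : (z⁻¹).re / 2 = σ / (σ ^ 2 + t ^ 2) := by
    rw [Complex.inv_re, Complex.normSq_apply, hre, him]
    field_simp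
  rw [auxK, hnorm, hinv, hre, Complex.digamma_def, logDeriv_apply,
    Real.log_div (by positivity) two_ne_zero] at hK
  have hs : (1 / 12) * (1 / (σ / 2) ^ 2) = 1 / (3 * σ ^ 2) := by
    field_simp
    norm_num
  rw [hs] at hK
  have hbdd : BddAbove (Set.range fun u : {u : ℝ // |u| ≤ T₀} =>
      (Real.log (Real.sqrt (σ ^ 2 + (u : ℝ) ^ 2) / (|(u : ℝ)| + 2)) -
        σ / (σ ^ 2 + (u : ℝ) ^ 2))) := by
    refine ⟨Real.log (Real.sqrt (σ ^ 2 + T₀ ^ 2) / 2), ?_⟩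
    rintro _ ⟨⟨u, hu⟩, rfl⟩
    have h1 : 0 < σ / (σ ^ 2 + u ^ 2) := by positivity
    have h2 : u ^ 2 ≤ T₀ ^ 2 := sq_le_sq' (abs_le.1 hu).1 (abs_le.1 hu).2
    have h3 : Real.log (Real.sqrt (σ ^ 2 + u ^ 2) / (|u| + 2)) ≤
        Real.log (Real.sqrt (σ ^ 2 + T₀ ^ 2) / 2) := by
      refine Real.log_le_log (by positivity) ?_
      gcongr
      linarith [abs_nonneg u]
    show Real.log (Real.sqrt (σ ^ 2 + u ^ 2) / (|u| + 2)) - σ / (σ ^ 2 + u ^ 2) ≤ _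
    linarith
  have hsup := le_ciSup hbdd ⟨t, ht⟩
  simp only at hsup
  rw [Real.log_div (by positivity) (by positivity)] at hsup
  linarith
end

section
/- Let θ > 1. Then the function φ_θ(v) = (θ−1)² − ((e^{−v} − e^{−θv})/v)² is increasing on (0, ∞); that is, for all 0 < v ≤ w one has φ_θ(v) ≤ φ_θ(w). -/
/-- **Monotonicity of the weight function `φ_θ`.**
Let `θ > 1` and `φ_θ(v) = (θ−1)² − ((e^{−v} − e^{−θv})/v)²`.  Then `φ_θ` is increasing on
`(0, ∞)`: for all `0 < v ≤ w` we have `φ_θ(v) ≤ φ_θ(w)`. -/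
theorem phi_theta_monotone (θ : ℝ) (hθ : 1 < θ) :
    ∀ v w : ℝ, 0 < v → v ≤ w →
      (θ - 1) ^ 2 - ((Real.exp (-v) - Real.exp (-θ * v)) / v) ^ 2 ≤
        (θ - 1) ^ 2 - ((Real.exp (-w) - Real.exp (-θ * w)) / w) ^ 2 := by
  intro v w hv hvw
  have hw : 0 < w := lt_of_lt_of_le hv hvw
  have key : ∀ x : ℝ, Real.exp (-x) - Real.exp (-θ * x)
      = Real.exp (-x) * (1 - Real.exp (-(θ - 1) * x)) := by
    intro x
    rw [mul_sub, ← Real.exp_add]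
    ring_nf
  have ha : 0 ≤ 1 - v / w := by rw [sub_nonneg, div_le_one hw]; exact hvw
  have hb : 0 ≤ v / w := by positivity
  have hcx := convexOn_exp.2 (Set.mem_univ (0 : ℝ)) (Set.mem_univ (-(θ - 1) * w))
    ha hb (by ring)
  have e1 : (1 - v / w) • (0 : ℝ) + (v / w) • (-(θ - 1) * w) = -(θ - 1) * v := by
    simp only [smul_eq_mul]
    field_simp
    ring
  rw [e1] at hcx
  simp only [smul_eq_mul, Real.exp_zero] at hcx
  have hpos : 0 ≤ 1 - Real.exp (-(θ - 1) * w) := by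
    rw [sub_nonneg, Real.exp_le_one_iff]
    nlinarith
  have h1 : (1 - Real.exp (-(θ - 1) * w)) / w ≤ (1 - Real.exp (-(θ - 1) * v)) / v := by
    rw [le_div_iff₀ hv]
    have e2 : (1 - Real.exp (-(θ - 1) * w)) / w * v
        = v / w - v / w * Real.exp (-(θ - 1) * w) := by ring
    linarith
  have h2 : Real.exp (-w) ≤ Real.exp (-v) := Real.exp_le_exp.2 (by linarith)
  have h0 : 0 ≤ (1 - Real.exp (-(θ - 1) * w)) / w := div_nonneg hpos hw.le
  rw [key, key, mul_div_assoc, mul_div_assoc]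
  have h3 := mul_le_mul h2 h1 h0 (Real.exp_pos _).le
  have h4 := pow_le_pow_left₀ (mul_nonneg (Real.exp_pos (-w)).le h0) h3 2
  linarith
end

section
/- Let θ > 1. Then for every v > 0 one has φ_θ(v) ≥ (θ−1)²·(1 − e^{−2v}); in particular, for any b > 0 and any 0 < v ≤ b, one has φ_θ(v) ≥ 2(θ−1)²·e^{−2b}·v. -/
/-- **Lower bounds for the weight function `φ_θ`.**
Let `θ > 1` and `φ_θ(v) = (θ−1)² − ((e^{−v} − e^{−θv})/v)²`.  Then for every `v > 0` one
has `φ_θ(v) ≥ (θ−1)²(1 − e^{−2v})`; in particular, for any `b > 0` and any `0 < v ≤ b`,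
`φ_θ(v) ≥ 2(θ−1)² e^{−2b} v`. -/
theorem phi_theta_lower_bound (θ : ℝ) (hθ : 1 < θ) :
    (∀ v : ℝ, 0 < v →
      (θ - 1) ^ 2 - ((Real.exp (-v) - Real.exp (-θ * v)) / v) ^ 2 ≥
        (θ - 1) ^ 2 * (1 - Real.exp (-2 * v))) ∧
    (∀ b : ℝ, 0 < b → ∀ v : ℝ, 0 < v → v ≤ b →
      (θ - 1) ^ 2 - ((Real.exp (-v) - Real.exp (-θ * v)) / v) ^ 2 ≥
        2 * (θ - 1) ^ 2 * Real.exp (-2 * b) * v) := by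
  have h1 : ∀ v : ℝ, 0 < v →
      (θ - 1) ^ 2 - ((Real.exp (-v) - Real.exp (-θ * v)) / v) ^ 2 ≥
        (θ - 1) ^ 2 * (1 - Real.exp (-2 * v)) := by
    intro v hv
    have e1 : Real.exp (-θ * v) = Real.exp (-v) * Real.exp (-((θ - 1) * v)) := by
      rw [← Real.exp_add]; congr 1; ring
    have e2 : Real.exp (-2 * v) = Real.exp (-v) ^ 2 := by
      rw [pow_two, ← Real.exp_add]; congr 1; ring
    have p := Real.exp_pos (-v)
    have q := Real.add_one_le_exp (-((θ - 1) * v))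
    have r : Real.exp (-θ * v) ≤ Real.exp (-v) := by
      apply Real.exp_le_exp.mpr; nlinarith
    have u : (Real.exp (-v) - Real.exp (-θ * v)) / v ≤ (θ - 1) * Real.exp (-v) := by
      rw [div_le_iff₀ hv, e1]; nlinarith
    have w : 0 ≤ (Real.exp (-v) - Real.exp (-θ * v)) / v :=
      div_nonneg (by linarith) hv.le
    have z := pow_le_pow_left₀ w u 2
    rw [mul_pow] at z
    rw [e2]
    linarith
  refine ⟨h1, ?_⟩
  intro b _ v hv hvb
  refine ge_trans (h1 v hv) ?_
  have a1 : Real.exp (-2 * b) ≤ Real.exp (-2 * v) := by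
    apply Real.exp_le_exp.mpr; linarith
  have a2 : Real.exp (-2 * v) * Real.exp (2 * v) = 1 := by
    rw [← Real.exp_add]; simp
  have a3 := Real.add_one_le_exp (2 * v)
  have a4 := Real.exp_pos (-2 * v)
  have a5 : 2 * Real.exp (-2 * b) * v ≤ 1 - Real.exp (-2 * v) := by
    have := mul_le_mul_of_nonneg_left a3 a4.le
    have := mul_le_mul_of_nonneg_right a1 hv.le
    linarith
  have := mul_le_mul_of_nonneg_left a5 (sq_nonneg (θ - 1))
  linarith
end
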